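/- Let G = (V,E) be a perfect graph and let d be the depth of a decomposition tree representing a decomposition of G into basic perfect graphs by means of 2-join and skew partition decompositions. Then xc(STAB(G)) ≤ 4^d · (2|V| + 2|E|). In particular, if d ≤ c·log|V| for a constant c > 0, then xc(STAB(G)) ≤ 2|V|^{c+2}. -/

import Mathlib

/-- A polytope is the convex hull of a finite set of points. -/
def IsPolytope {E : Type*} [AddCommGroup E] [Module ℝ E] (P : Set E) : Prop :=
  ∃ F : Set E, F.Finite ∧ P = convexHull ℝ F

/-- An (exposed) face of a set `Q ⊆ ℝ^κ`. -/
def IsExposedFace {κ : Type*} [Fintype κ] (Q F : Set (κ → ℝ)) : Prop :=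
  F ⊆ Q ∧ ∃ (c : κ → ℝ) (α : ℝ), (∀ y ∈ Q, ∑ i, c i * y i ≤ α) ∧
    F = {y ∈ Q | ∑ i, c i * y i = α}

/-- A facet of `Q`: a maximal proper nonempty face of `Q`. -/
def IsFacet {κ : Type*} [Fintype κ] (Q F : Set (κ → ℝ)) : Prop :=
  IsExposedFace Q F ∧ F.Nonempty ∧ F ≠ Q ∧
    ∀ F' : Set (κ → ℝ), IsExposedFace Q F' → F'.Nonempty → F' ≠ Q → F ⊆ F' → F' = F

/-- The size of a polytope: its number of facets. -/
noncomputable def polySize {κ : Type*} [Fintype κ] (Q : Set (κ → ℝ)) : ℕ :=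
  {F : Set (κ → ℝ) | IsFacet Q F}.ncard

/-- `Q` is an extension of `P` if `Q` is a polytope and some linear map sends `Q` onto `P`. -/
def IsExtension {ι κ : Type*} [Fintype ι] [Fintype κ]
    (P : Set (ι → ℝ)) (Q : Set (κ → ℝ)) : Prop :=
  IsPolytope Q ∧ ∃ π : (κ → ℝ) →ₗ[ℝ] (ι → ℝ), π '' Q = P

/-- The extension complexity of `P`: the minimum number of facets of an extension of `P`. -/
noncomputable def xc {ι : Type*} [Fintype ι] (P : Set (ι → ℝ)) : ℕ :=
  sInf {r : ℕ | ∃ (k : ℕ) (Q : Set (Fin k → ℝ)), IsExtension P Q ∧ polySize Q = r}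

/-- The stable set polytope of a graph: the convex hull of the characteristic vectors of
its independent (stable) sets. -/
def stab {V : Type*} [Fintype V] (G : SimpleGraph V) : Set (V → ℝ) :=
  convexHull ℝ {x : V → ℝ |
    ∃ S : Set V, (∀ u ∈ S, ∀ v ∈ S, ¬ G.Adj u v) ∧ x = S.indicator 1}

/-- The clique number of a graph. -/
noncomputable def cliqueNum {V : Type*} (G : SimpleGraph V) : ℕ :=
  sSup {n : ℕ | ∃ s : Finset V, G.IsNClique n s}

/-- A graph is perfect if every induced subgraph has chromatic number equal to its
clique number. -/
def IsPerfect {V : Type*} (G : SimpleGraph V) : Prop :=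
  ∀ S : Set V, (G.induce S).chromaticNumber = (cliqueNum (G.induce S) : ℕ∞)

/-- A graph is bipartite if the vertices split into two parts so that every edge goes
between the parts. -/
def IsBipartite {V : Type*} (G : SimpleGraph V) : Prop :=
  ∃ s : Set V, ∀ ⦃u v⦄, G.Adj u v → (u ∈ s ↔ v ∉ s)

/-- The line graph of a graph `H`: vertices are the edges of `H`, two being adjacent when
they share an endpoint. -/
def lineGraph {W : Type*} (H : SimpleGraph W) : SimpleGraph H.edgeSet :=
  SimpleGraph.fromRel fun e f => ∃ v : W, v ∈ (e : Sym2 W) ∧ v ∈ (f : Sym2 W)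

/-- The double-split graph with parameters `(p, q, L)`.  The vertices `inl (i, false)` and
`inl (i, true)` are `aᵢ` and `bᵢ`, while `inr (j, false)` and `inr (j, true)` are `xⱼ`
and `yⱼ`.  Edges: `{aᵢ, bᵢ}`; `{xᵢ, yⱼ}` for `i ≠ j`; and between the two sides,
`{aᵢ, xⱼ}`, `{bᵢ, yⱼ}` for `j ∈ L i`, and `{aᵢ, yⱼ}`, `{bᵢ, xⱼ}` for `j ∉ L i`. -/
def doubleSplitGraph (p q : ℕ) (L : Fin p → Set (Fin q)) :
    SimpleGraph ((Fin p × Bool) ⊕ (Fin q × Bool)) :=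
  SimpleGraph.fromRel fun u v =>
    match u, v with
    | Sum.inl (i, s), Sum.inl (i', s') => i = i' ∧ s ≠ s'
    | Sum.inr (j, s), Sum.inr (j', s') => j ≠ j' ∧ s ≠ s'
    | Sum.inl (i, s), Sum.inr (j, t) => j ∈ L i ↔ s = t
    | Sum.inr _, Sum.inl _ => False

/-- A basic perfect graph: bipartite, the complement of a bipartite graph, the line graph
of a bipartite graph, the complement of such a line graph, or a double-split graph. -/
def IsBasicPerfect {V : Type*} (G : SimpleGraph V) : Prop :=
  IsBipartite G ∨ IsBipartite Gᶜ ∨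
  (∃ (W : Type) (H : SimpleGraph W), IsBipartite H ∧ Nonempty (G ≃g lineGraph H)) ∨
  (∃ (W : Type) (H : SimpleGraph W), IsBipartite H ∧ Nonempty (Gᶜ ≃g lineGraph H)) ∨
  (∃ (p q : ℕ) (L : Fin p → Set (Fin q)), 2 ≤ p ∧ 2 ≤ q ∧
    Nonempty (G ≃g doubleSplitGraph p q L))

/-- A 2-join of `G` with parts `(V₁, V₂)`: there are disjoint nonempty `Aₖ, Bₖ ⊆ Vₖ` such
that every vertex of `A₁` is adjacent to every vertex of `A₂`, every vertex of `B₁` is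
adjacent to every vertex of `B₂`, and there are no other edges between `V₁` and `V₂`. -/
def Is2Join {V : Type*} (G : SimpleGraph V) (V₁ V₂ : Set V) : Prop :=
  V₁ ∪ V₂ = Set.univ ∧ Disjoint V₁ V₂ ∧
  ∃ A₁ B₁ A₂ B₂ : Set V, A₁ ⊆ V₁ ∧ B₁ ⊆ V₁ ∧ A₂ ⊆ V₂ ∧ B₂ ⊆ V₂ ∧
    A₁.Nonempty ∧ B₁.Nonempty ∧ A₂.Nonempty ∧ B₂.Nonempty ∧
    Disjoint A₁ B₁ ∧ Disjoint A₂ B₂ ∧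
    (∀ a₁ ∈ A₁, ∀ a₂ ∈ A₂, G.Adj a₁ a₂) ∧
    (∀ b₁ ∈ B₁, ∀ b₂ ∈ B₂, G.Adj b₁ b₂) ∧
    (∀ v₁ ∈ V₁, ∀ v₂ ∈ V₂, G.Adj v₁ v₂ →
      (v₁ ∈ A₁ ∧ v₂ ∈ A₂) ∨ (v₁ ∈ B₁ ∧ v₂ ∈ B₂))

/-- A skew partition of `G`: a partition of the vertices into nonempty sets
`(A₁, B₁, A₂, B₂)` with all edges present between `A₁` and `A₂` and no edges between
`B₁` and `B₂`. -/
def IsSkewPartition {V : Type*} (G : SimpleGraph V) (A₁ B₁ A₂ B₂ : Set V) : Prop :=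
  A₁.Nonempty ∧ B₁.Nonempty ∧ A₂.Nonempty ∧ B₂.Nonempty ∧
  A₁ ∪ B₁ ∪ A₂ ∪ B₂ = Set.univ ∧
  Disjoint A₁ B₁ ∧ Disjoint A₁ A₂ ∧ Disjoint A₁ B₂ ∧
  Disjoint B₁ A₂ ∧ Disjoint B₁ B₂ ∧ Disjoint A₂ B₂ ∧
  (∀ a₁ ∈ A₁, ∀ a₂ ∈ A₂, G.Adj a₁ a₂) ∧
  (∀ b₁ ∈ B₁, ∀ b₂ ∈ B₂, ¬ G.Adj b₁ b₂)

/-- `DecompDepth d V G` : the graph `G` admits a decomposition tree of depth (at most) `d`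
into basic perfect graphs, by means of 2-join and skew partition decompositions. -/
def DecompDepth : ℕ → (V : Type) → SimpleGraph V → Prop
  | 0, _, G => IsBasicPerfect G
  | d + 1, V, G =>
      IsBasicPerfect G ∨
      (∃ V₁ V₂ : Set V, Is2Join G V₁ V₂ ∧
        DecompDepth d V₁ (G.induce V₁) ∧ DecompDepth d V₂ (G.induce V₂)) ∨
      (∃ A₁ B₁ A₂ B₂ : Set V, IsSkewPartition G A₁ B₁ A₂ B₂ ∧
        DecompDepth d ↥(A₁ ∪ B₁) (G.induce (A₁ ∪ B₁)) ∧
        DecompDepth d ↥(A₂ ∪ B₂) (G.induce (A₂ ∪ B₂)) ∧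
        DecompDepth d ↥(A₁ ∪ B₂) (G.induce (A₁ ∪ B₂)) ∧
        DecompDepth d ↥(A₂ ∪ B₁) (G.induce (A₂ ∪ B₁)))

open scoped Classical in
theorem exists_eps {r : ℕ} (y d : Fin r → ℝ) (hy : ∀ t, 0 ≤ y t)
    (hd : ∀ t, y t = 0 → d t = 0) :
    ∃ ε : ℝ, 0 < ε ∧ ∀ t, ε * |d t| ≤ y t := by
  have h : ∀ t, ∀ᶠ ε in nhdsWithin (0:ℝ) (Set.Ioi 0), ε * |d t| ≤ y t := by
    intro t
    rcases (hy t).eq_or_lt with h0 | h0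
    · rw [hd t h0.symm, ← h0]; simp
    · have hc : Filter.Tendsto (fun ε : ℝ => ε * |d t|) (nhds 0) (nhds (0 * |d t|)) :=
        (continuous_id.mul continuous_const).tendsto 0
      rw [zero_mul] at hc
      exact ((hc.eventually (gt_mem_nhds h0)).mono (fun _ h => le_of_lt h)).filter_mono
        nhdsWithin_le_nhds
  have h2 := (Filter.eventually_all.2 h).and self_mem_nhdsWithin
  obtain ⟨ε, h3, h4⟩ := h2.exists
  exact ⟨ε, h4, h3⟩

/-- Sets that are slices of the nonnegative orthant. -/
def SliceSet {r : ℕ} (Q : Set (Fin r → ℝ)) : Prop :=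
  (∀ y ∈ Q, ∀ t, 0 ≤ y t) ∧
  ∀ y ∈ Q, ∀ z ∈ Q, ∀ ε : ℝ, (∀ t, 0 ≤ y t + ε * (y t - z t)) →
    (fun t => y t + ε * (y t - z t)) ∈ Q

theorem SliceSet.convex {r : ℕ} {Q : Set (Fin r → ℝ)} (h : SliceSet Q) : Convex ℝ Q := by
  intro y hy z hz a b ha hb hab
  have := h.2 y hy z hz (-b) (by
    intro t
    have h1 := h.1 y hy t
    have h2 := h.1 z hz t
    have : y t + -b * (y t - z t) = a * y t + b * z t := by
      rw [← eq_sub_iff_add_eq] at hab; rw [hab]; ring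
    rw [this]; positivity)
  convert this using 1
  funext t
  simp only [Pi.add_apply, Pi.smul_apply, smul_eq_mul]
  rw [← eq_sub_iff_add_eq] at hab; rw [hab]; ring

theorem SliceSet.isPolytope {r : ℕ} {Q : Set (Fin r → ℝ)} (h : SliceSet Q)
    (hc : IsCompact Q) : IsPolytope Q := by
  have hfin : (Q.extremePoints ℝ).Finite := by
    refine Set.Finite.of_finite_image (f := fun y : Fin r → ℝ => {t | y t = 0})
      (Set.toFinite _) ?_
    intro y hy z hz hyz
    have hyQ := hy.1
    have hzQ := hz.1
    obtain ⟨ε, he, hε⟩ := exists_eps y (fun t => y t - z t) (h.1 y hyQ) (by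
      intro t ht
      have : t ∈ {t | z t = 0} := by
        rw [← show _ = {t | z t = 0} from hyz]; exact ht
      have : z t = 0 := this
      simp [ht, this])
    have h1 := h.2 y hyQ z hzQ ε (by
      intro t
      have := hε t
      have := neg_abs_le (y t - z t)
      nlinarith)
    have h2 := h.2 y hyQ z hzQ (-ε) (by
      intro t
      have := hε t
      have := le_abs_self (y t - z t)
      nlinarith)
    have h3 := hy.2 h1 h2 ⟨1/2, 1/2, by norm_num, by norm_num, by norm_num, by
      funext t; simp; ring⟩
    funext t
    have h4 : y t + ε * (y t - z t) = y t := congrFun h3 t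
    have : ε * (y t - z t) = 0 := by linarith
    rcases mul_eq_zero.1 this with h5 | h5
    · exact absurd h5 he.ne'
    · linarith
  refine ⟨Q.extremePoints ℝ, hfin, ?_⟩
  have := closure_convexHull_extremePoints hc h.convex
  rw [(hfin.isCompact_convexHull (𝕜 := ℝ)).isClosed.closure_eq] at this
  exact this.symm

theorem SliceSet.polySize_le {r : ℕ} {Q : Set (Fin r → ℝ)} (h : SliceSet Q) :
    polySize Q ≤ r := by
  have hsub : {F : Set (Fin r → ℝ) | IsFacet Q F} ⊆
      Set.range (fun t : Fin r => {y ∈ Q | y t = 0}) := by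
    rintro F ⟨⟨hFQ, c, α, hle, hF⟩, hne, hFne, hmax⟩
    by_cases hex : ∃ t, (∀ y ∈ F, y t = 0) ∧ ∃ y ∈ Q, y t ≠ 0
    · obtain ⟨t, ht, y, hy, hyt⟩ := hex
      refine ⟨t, hmax _ ⟨fun z hz => hz.1, fun i => if i = t then -1 else 0, 0, ?_, ?_⟩ ?_ ?_ ?_⟩
      · intro z hz
        simp [h.1 z hz t]
      · ext z; simp
      · obtain ⟨z, hz⟩ := hne
        exact ⟨z, hFQ hz, ht z hz⟩
      · intro he
        rw [← he] at hy
        exact hyt hy.2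
      · intro z hz
        exact ⟨hFQ hz, ht z hz⟩
    · exfalso
      push Not at hex
      have key : ∀ s : Finset (Fin r), ∃ y ∈ F, ∀ t ∈ s, y t = 0 → ∀ z ∈ Q, z t = 0 := by
        intro s
        induction s using Finset.induction_on with
        | empty => obtain ⟨z, hz⟩ := hne; exact ⟨z, hz, by simp⟩
        | insert t s _ ih =>
          obtain ⟨y, hy, hys⟩ := ih
          by_cases h0 : ∀ z ∈ F, z t = 0
          · refine ⟨y, hy, ?_⟩
            intro t' ht' hy0
            rcases Finset.mem_insert.1 ht' with rfl | h'
            · exact hex _ h0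
            · exact hys _ h' hy0
          · push Not at h0
            obtain ⟨z, hz, hzt⟩ := h0
            have hyQ := hFQ hy
            have hzQ := hFQ hz
            refine ⟨(1/2:ℝ) • y + (1/2:ℝ) • z, ?_, ?_⟩
            · have hm := h.convex hyQ hzQ (a := 1/2) (b := 1/2) (by norm_num) (by norm_num)
                (by norm_num)
              rw [hF] at hy hz ⊢
              refine ⟨hm, ?_⟩
              have e1 := hy.2
              have e2 := hz.2
              have : ∑ i, c i * ((1/2:ℝ) • y + (1/2:ℝ) • z) i
                  = (1/2) * ∑ i, c i * y i + (1/2) * ∑ i, c i * z i := by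
                rw [Finset.mul_sum, Finset.mul_sum, ← Finset.sum_add_distrib]
                refine Finset.sum_congr rfl fun i _ => ?_
                simp; ring
              rw [this, e1, e2]; ring
            · intro t' ht' h0
              simp only [Pi.add_apply, Pi.smul_apply, smul_eq_mul] at h0
              have p1 := h.1 y hyQ t'
              have p2 := h.1 z hzQ t'
              rcases Finset.mem_insert.1 ht' with rfl | h'
              · exact absurd (by linarith) hzt
              · exact hys _ h' (by linarith)
      obtain ⟨y, hy, hyt⟩ := key Finset.univ
      apply hFne
      refine Set.Subset.antisymm hFQ fun q hq => ?_
      have hyQ := hFQ hy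
      obtain ⟨ε, he, hε⟩ := exists_eps y (fun t => y t - q t) (h.1 y hyQ) (by
        intro t ht
        simp [ht, hyt t (Finset.mem_univ _) ht q hq])
      have h1 := h.2 y hyQ q hq ε (by
        intro t
        have := hε t
        have := neg_abs_le (y t - q t)
        nlinarith)
      have h2 := hle _ h1
      rw [hF] at hy ⊢
      refine ⟨hq, le_antisymm (hle q hq) ?_⟩
      have e1 := hy.2
      have : ∑ i, c i * (y i + ε * (y i - q i))
          = ∑ i, c i * y i + ε * (∑ i, c i * y i - ∑ i, c i * q i) := by
        rw [← Finset.sum_sub_distrib, Finset.mul_sum, ← Finset.sum_add_distrib]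
        refine Finset.sum_congr rfl fun i _ => ?_
        ring
      rw [this, e1] at h2
      by_contra hlt
      push Not at hlt
      have : 0 < ε * (α - ∑ i, c i * q i) := mul_pos he (by linarith)
      linarith
  unfold polySize
  calc _ ≤ (Set.range (fun t : Fin r => {y ∈ Q | y t = 0})).ncard :=
        Set.ncard_le_ncard hsub (Set.finite_range _)
    _ ≤ Nat.card (Fin r) := by
        rw [← Set.image_univ]
        refine (Set.ncard_image_le Set.finite_univ).trans ?_
        rw [Set.ncard_univ]
    _ = r := by simp


/-- Weighted colouring of perfect graphs. -/
theorem weighted_colouring {V : Type} [Fintype V] [DecidableEq V] (G : SimpleGraph V)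
    (hG : IsPerfect G) :
    ∀ (m N : ℕ) (w : V → ℕ), ∑ v, w v ≤ m →
      (∀ C : Finset V, G.IsClique (C : Set V) → ∑ v ∈ C, w v ≤ N) →
      ∃ S : Fin N → Finset V, (∀ i, ∀ u ∈ S i, ∀ v ∈ S i, ¬ G.Adj u v) ∧
        ∀ v, w v ≤ (Finset.univ.filter fun i => v ∈ S i).card := by
  intro m
  induction m with
  | zero =>
    intro N w hw _
    refine ⟨fun _ => ∅, by simp, fun v => ?_⟩
    have : w v ≤ ∑ v, w v := Finset.single_le_sum (f := w) (fun _ _ => Nat.zero_le _) (Finset.mem_univ v)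
    omega
  | succ m ih =>
    intro N w hw hC
    by_cases hbig : ∃ v, 2 ≤ w v
    · obtain ⟨v, hv⟩ := hbig
      set w' : V → ℕ := fun u => if u = v then w u - 1 else w u with hw'
      have hw'sum : ∑ u, w' u + 1 = ∑ u, w u := by
        rw [← Finset.add_sum_erase _ w' (Finset.mem_univ v),
          ← Finset.add_sum_erase _ w (Finset.mem_univ v)]
        have : ∑ x ∈ Finset.univ.erase v, w' x = ∑ x ∈ Finset.univ.erase v, w x := by
          refine Finset.sum_congr rfl fun x hx => ?_
          simp [hw', (Finset.mem_erase.1 hx).1]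
        rw [this]; simp [hw']; omega
      have hw'le : ∀ u, w' u ≤ w u := by
        intro u; simp only [hw']; split_ifs <;> omega
      have hNpos : 2 ≤ N := by
        have := hC {v} (by simp)
        simp at this; omega
      -- build an N-cover from an (N-1)-cover and a stable set
      have build : ∀ (T : Finset V) (w'' : V → ℕ), (∀ u ∈ T, ∀ x ∈ T, ¬ G.Adj u x) →
          (∀ u, w u ≤ w'' u + (if u ∈ T then 1 else 0)) → ∑ u, w'' u ≤ m →
          (∀ C : Finset V, G.IsClique (C : Set V) → ∑ v ∈ C, w'' v ≤ N - 1) →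
          ∃ S : Fin N → Finset V, (∀ i, ∀ u ∈ S i, ∀ v ∈ S i, ¬ G.Adj u v) ∧
            ∀ v, w v ≤ (Finset.univ.filter fun i => v ∈ S i).card := by
        intro T w'' hT hle hsum hcl
        obtain ⟨S, hS, hcov⟩ := ih (N - 1) w'' hsum hcl
        obtain ⟨M, rfl⟩ : ∃ M, N = M + 1 := ⟨N - 1, by omega⟩
        refine ⟨Fin.cons T S, ?_, ?_⟩
        · intro i
          refine Fin.cases ?_ (fun j => ?_) i
          · simpa using hT
          · simpa using hS j
        · intro u
          refine (hle u).trans ?_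
          have h1 := hcov u
          rw [Finset.card_filter] at h1 ⊢
          rw [Fin.sum_univ_succ]
          simp only [Fin.cons_zero, Fin.cons_succ]
          have : (∑ i : Fin (M + 1 - 1), if u ∈ S i then 1 else 0)
             = ∑ i : Fin M, if u ∈ S i then 1 else 0 := rfl
          omega
      by_cases hcl' : ∀ C : Finset V, G.IsClique (C : Set V) → ∑ v ∈ C, w' v ≤ N - 1
      · refine build {v} w' (by simp) ?_ (by omega) hcl'
        intro u
        simp only [hw', Finset.mem_singleton]
        split_ifs <;> omega
      · obtain ⟨S, hS, hcov⟩ := ih N w' (by omega)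
          (fun C h => (Finset.sum_le_sum fun u _ => hw'le u).trans (hC C h))
        have h1 : 0 < (Finset.univ.filter fun i => v ∈ S i).card := by
          refine lt_of_lt_of_le ?_ (hcov v)
          simp [hw']; omega
        obtain ⟨i, hi⟩ := Finset.card_pos.1 h1
        have hvi : v ∈ S i := (Finset.mem_filter.1 hi).2
        refine build (S i) (fun u => w u - if u ∈ S i then 1 else 0) (hS i) ?_ ?_ ?_
        · intro u; omega
        · have : ∑ u, (w u - if u ∈ S i then 1 else 0) < ∑ u, w u := by
            refine Finset.sum_lt_sum (fun u _ => Nat.sub_le _ _) ⟨v, Finset.mem_univ _, ?_⟩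
            simp [hvi]; omega
          omega
        · intro C hCc
          by_contra hlt
          push Not at hlt
          have hCN := hC C hCc
          have hle : ∀ u ∈ C, (w u - if u ∈ S i then 1 else 0) ≤ w u := fun u _ => Nat.sub_le _ _
          have hsum_eq : ∑ u ∈ C, (w u - if u ∈ S i then 1 else 0) = ∑ u ∈ C, w u := by
            have := Finset.sum_le_sum hle
            omega
          have heq := (Finset.sum_eq_sum_iff_of_le hle).1 hsum_eq
          have hz : ∀ u ∈ C, u ∈ S i → w u = 0 := by
            intro u hu hui
            have := heq u hu
            simp [hui] at this; omega
          have hvC : v ∉ C := fun h => by have := hz v h hvi; omega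
          have hw'C : ∑ u ∈ C, w' u = ∑ u ∈ C, w u := by
            refine Finset.sum_congr rfl fun u hu => ?_
            have : u ≠ v := fun h => hvC (h ▸ hu)
            simp [hw', this]
          set D := C.filter (fun u => 0 < w' u) with hD
          have hDC : ∑ u ∈ D, w' u = ∑ u ∈ C, w' u := by
            rw [hD, Finset.sum_filter]
            refine Finset.sum_congr rfl fun u _ => ?_
            split_ifs <;> omega
          have hb : ∑ u ∈ D, w' u ≤ ∑ j, (D.filter fun u => u ∈ S j).card := by
            calc ∑ u ∈ D, w' u ≤ ∑ u ∈ D, ∑ j, (if u ∈ S j then 1 else 0) := by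
                  refine Finset.sum_le_sum fun u _ => ?_
                  have := hcov u
                  rwa [Finset.card_filter] at this
              _ = _ := by
                  rw [Finset.sum_comm]
                  refine Finset.sum_congr rfl fun j _ => ?_
                  rw [Finset.card_filter]
          have hc1 : ∀ j, (D.filter fun u => u ∈ S j).card ≤ 1 := by
            intro j
            rw [Finset.card_le_one]
            intro a ha b hb
            simp only [Finset.mem_filter, hD] at ha hb
            by_contra hab
            exact hS j a ha.2 b hb.2 (hCc ha.1.1 hb.1.1 hab)
          have hc0 : (D.filter fun u => u ∈ S i).card = 0 := by
            rw [Finset.card_eq_zero, Finset.filter_eq_empty_iff]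
            intro u hu hui
            rw [hD, Finset.mem_filter] at hu
            have := hz u hu.1 hui
            have := hw'le u
            omega
          have : ∑ j, (D.filter fun u => u ∈ S j).card ≤ N - 1 := by
            rw [← Finset.add_sum_erase _ _ (Finset.mem_univ i), hc0, zero_add]
            refine (Finset.sum_le_card_nsmul _ _ 1 fun j _ => hc1 j).trans ?_
            rw [Finset.card_erase_of_mem (Finset.mem_univ i)]
            simp
          omega
    · push Not at hbig
      set P : Set V := {v | w v = 1} with hP
      have hcn : cliqueNum (G.induce P) ≤ N := by
        unfold cliqueNum
        refine csSup_le (Set.nonempty_of_mem (x := 0) ⟨∅, by simp⟩) ?_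
        rintro n ⟨s, hs⟩
        have h1 := hC (s.map (Function.Embedding.subtype _)) (by
          intro a ha b hb hab
          simp only [Finset.coe_map, Set.mem_image, Function.Embedding.coe_subtype] at ha hb
          obtain ⟨a', ha', rfl⟩ := ha
          obtain ⟨b', hb', rfl⟩ := hb
          exact hs.1 ha' hb' (fun h => hab (congrArg _ h)))
        rw [Finset.sum_map] at h1
        have : ∑ x ∈ s, w (Function.Embedding.subtype (· ∈ P) x) = s.card := by
          rw [Finset.card_eq_sum_ones]
          refine Finset.sum_congr rfl fun x _ => x.2
        rw [← hs.2]
        exact this.symm.le.trans h1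
      have hcol : (G.induce P).Colorable N := by
        rw [← SimpleGraph.chromaticNumber_le_iff_colorable, hG P]
        exact_mod_cast hcn
      obtain ⟨col⟩ := hcol
      refine ⟨fun i => Finset.univ.filter fun v => ∃ h : v ∈ P, col ⟨v, h⟩ = i, ?_, ?_⟩
      · intro i u hu v hv hadj
        simp only [Finset.mem_filter, Finset.mem_univ, true_and] at hu hv
        obtain ⟨hu, hu'⟩ := hu
        obtain ⟨hv, hv'⟩ := hv
        have : (G.induce P).Adj ⟨u, hu⟩ ⟨v, hv⟩ := hadj
        exact col.valid this (hu'.trans hv'.symm)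
      · intro v
        have := hbig v
        by_cases hv : w v = 1
        · rw [hv, Nat.one_le_iff_ne_zero, ← Nat.pos_iff_ne_zero, Finset.card_pos]
          exact ⟨col ⟨v, hv⟩, Finset.mem_filter.2 ⟨Finset.mem_univ _, Finset.mem_filter.2 ⟨Finset.mem_univ _, hv, rfl⟩⟩⟩
        · omega

theorem mem_stab_of_clique {V : Type} [Fintype V] (G : SimpleGraph V) (hG : IsPerfect G)
    (x : V → ℝ) (hx : ∀ v, 0 ≤ x v)
    (hC : ∀ C : Finset V, G.IsClique (C : Set V) → C.Nonempty → ∑ v ∈ C, x v ≤ 1) :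
    x ∈ stab G := by
  classical
  have hclosed : IsClosed (stab G) := by
    unfold stab
    refine (Set.Finite.isCompact_convexHull (𝕜 := ℝ) ?_).isClosed
    refine (Set.finite_range (fun S : Set V => (S.indicator 1 : V → ℝ))).subset ?_
    rintro _ ⟨S, _, rfl⟩
    exact ⟨S, rfl⟩
  have hmem : ∀ n : ℕ, 0 < n → (fun v => ((⌊x v * n⌋₊ : ℕ) : ℝ) / n) ∈ stab G := by
    intro n hn
    have hn' : (0:ℝ) < n := by exact_mod_cast hn
    obtain ⟨S, hS, hcov⟩ := weighted_colouring G hG _ n (fun v => ⌊x v * n⌋₊) le_rfl (by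
      intro C hc
      rcases C.eq_empty_or_nonempty with rfl | hne
      · simp
      have h1 := hC C hc hne
      have : (∑ v ∈ C, ((⌊x v * n⌋₊ : ℕ) : ℝ)) ≤ ∑ v ∈ C, x v * n :=
        Finset.sum_le_sum fun v _ => Nat.floor_le (mul_nonneg (hx v) hn'.le)
      rw [← Finset.sum_mul] at this
      have h2 : (∑ v ∈ C, ((⌊x v * n⌋₊ : ℕ) : ℝ)) ≤ n := by nlinarith
      exact_mod_cast h2)
    choose T hT hTc using fun v => Finset.exists_subset_card_eq (hcov v)
    have hconv : Convex ℝ (stab G) := convex_convexHull _ _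
    have := hconv.sum_mem (t := (Finset.univ : Finset (Fin n))) (w := fun _ => (1:ℝ) / n)
      (z := fun i => ({v | i ∈ T v} : Set V).indicator 1) (by intros; positivity)
      (by simp; field_simp) (by
        intro i _
        apply subset_convexHull
        refine ⟨_, ?_, rfl⟩
        intro u hu v hv
        have h1 := hT u hu
        have h2 := hT v hv
        simp only [Finset.mem_filter] at h1 h2
        exact hS i u h1.2 v h2.2)
    convert this using 1
    funext v
    rw [Finset.sum_apply]
    simp only [Pi.smul_apply, smul_eq_mul, Set.indicator_apply, Set.mem_ofPred_eq, Pi.one_apply]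
    rw [← Finset.mul_sum, Finset.sum_ite_mem, Finset.univ_inter, ← hTc v]
    simp
    ring
  refine hclosed.mem_of_tendsto (b := Filter.atTop)
    (f := fun n : ℕ => fun v => ((⌊x v * n⌋₊ : ℕ) : ℝ) / n) ?_
    (Filter.eventually_atTop.2 ⟨1, fun n hn => hmem n hn⟩)
  rw [tendsto_pi_nhds]
  intro v
  exact (tendsto_nat_floor_mul_div_atTop (hx v)).comp tendsto_natCast_atTop_atTop


/-- Stable sets of `G`. -/
def Stb {V : Type} (G : SimpleGraph V) : Type := {S : Set V // ∀ u ∈ S, ∀ v ∈ S, ¬ G.Adj u v}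

open scoped Classical in
/-- Row of the slack matrix for the nonnegativity constraint at `v`. -/
noncomputable def rho {V : Type} (G : SimpleGraph V) (v : V) : Stb G → NNReal :=
  fun S => if v ∈ S.1 then 1 else 0

open scoped Classical in
/-- Row of the slack matrix for the clique constraint of `C`. -/
noncomputable def sig {V : Type} (G : SimpleGraph V) (C : Set V) : Stb G → NNReal :=
  fun S => if ∃ v, v ∈ C ∧ v ∈ S.1 then 0 else 1

/-- `F` is a family whose cone contains all rows of the slack matrix. -/
def Cert {V : Type} (G : SimpleGraph V) (F : Finset (Stb G → NNReal)) : Prop :=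
  (∀ v, rho G v ∈ Submodule.span NNReal (F : Set (Stb G → NNReal))) ∧
  ∀ C : Set V, G.IsClique C → C.Nonempty →
    sig G C ∈ Submodule.span NNReal (F : Set (Stb G → NNReal))

/-- The slack matrix has nonnegative rank at most `r`. -/
def HasRank {V : Type} (G : SimpleGraph V) (r : ℕ) : Prop :=
  ∃ F : Finset (Stb G → NNReal), F.card ≤ r ∧ Cert G F

theorem sum_rho_add_sig {V : Type} (G : SimpleGraph V) (C : Finset V)
    (hC : G.IsClique (C : Set V)) (S : Stb G) :
    ∑ v ∈ C, rho G v S + sig G C S = 1 := by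
  classical
  unfold rho sig
  by_cases h : ∃ v, v ∈ (C : Set V) ∧ v ∈ S.1
  · obtain ⟨v, hv, hS⟩ := h
    rw [if_pos ⟨v, hv, hS⟩, Finset.sum_eq_single v]
    · simp [hS]
    · intro u hu huv
      rw [if_neg]
      intro huS
      exact S.2 u huS v hS (hC hu hv huv)
    · intro h; exact absurd hv h
  · rw [if_neg h, Finset.sum_eq_zero]
    · simp
    · intro v hv
      rw [if_neg]
      intro hS
      exact h ⟨v, hv, hS⟩

theorem xc_le_of_hasRank {V : Type} [Fintype V] (G : SimpleGraph V) (hG : IsPerfect G)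
    (r : ℕ) (h : HasRank G r) : xc (stab G) ≤ r := by
  classical
  obtain ⟨F, hFr, hrho, hsig⟩ := h
  refine le_trans ?_ hFr
  generalize hk : F.card = k
  obtain ⟨f, hf⟩ : ∃ f : Fin k → (Stb G → NNReal), Set.range f = (F : Set _) := by
    subst hk
    refine ⟨fun i => (F.equivFin.symm i : _), ?_⟩
    ext g
    constructor
    · rintro ⟨i, rfl⟩; exact (F.equivFin.symm i).2
    · intro hg; exact ⟨F.equivFin ⟨g, hg⟩, by simp⟩
  simp only [← hf, Submodule.mem_span_range_iff_exists_fun] at hrho hsig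
  choose a ha using hrho
  have hsig' : ∀ C : Finset V, ∃ c : Fin k → NNReal, G.IsClique (C : Set V) → C.Nonempty →
      ∑ i, c i • f i = sig G C := by
    intro C
    by_cases h1 : G.IsClique (C : Set V) ∧ C.Nonempty
    · obtain ⟨c, hc⟩ := hsig C h1.1 h1.2
      exact ⟨c, fun _ _ => hc⟩
    · exact ⟨0, fun h2 h3 => absurd ⟨h2, h3⟩ h1⟩
  choose b hb using hsig'
  have ha' : ∀ v S, ∑ t, (a v t : ℝ) * (f t S : ℝ) = rho G v S := by
    intro v S
    rw [← ha v, Finset.sum_apply]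
    push_cast
    rfl
  have hb' : ∀ C : Finset V, G.IsClique (C : Set V) → C.Nonempty → ∀ S,
      ∑ t, (b C t : ℝ) * (f t S : ℝ) = sig G C S := by
    intro C h1 h2 S
    rw [← hb C h1 h2, Finset.sum_apply]
    push_cast
    rfl
  set K : Finset V → Fin k → ℝ := fun C t => ∑ v ∈ C, (a v t : ℝ) + b C t with hK
  have hK0 : ∀ C t, 0 ≤ K C t := fun C t => by
    simp only [hK]; positivity
  set useful : Fin k → Prop := fun t => ∃ C : Finset V, G.IsClique (C : Set V) ∧ C.Nonempty ∧
    K C t ≠ 0 with huse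
  set Q : Set (Fin k → ℝ) := {y | (∀ t, 0 ≤ y t) ∧
    (∀ C : Finset V, G.IsClique (C : Set V) → C.Nonempty → ∑ t, K C t * y t = 1) ∧
    ∀ t, ¬ useful t → y t = 0} with hQ
  have hslice : SliceSet Q := by
    refine ⟨fun y hy => hy.1, fun y hy z hz ε hε => ⟨hε, ?_, ?_⟩⟩
    · intro C h1 h2
      have e1 := hy.2.1 C h1 h2
      have e2 := hz.2.1 C h1 h2
      have : ∑ t, K C t * (y t + ε * (y t - z t))
          = ∑ t, K C t * y t + ε * (∑ t, K C t * y t - ∑ t, K C t * z t) := by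
        rw [← Finset.sum_sub_distrib, Finset.mul_sum, ← Finset.sum_add_distrib]
        refine Finset.sum_congr rfl fun i _ => ?_
        ring
      rw [this, e1, e2]; ring
    · intro t ht
      simp [hy.2.2 t ht, hz.2.2 t ht]
  have hclosed : IsClosed Q := by
    have : Q = (⋂ t, {y | 0 ≤ y t}) ∩ ((⋂ (C : Finset V) (_ : G.IsClique (C : Set V))
        (_ : C.Nonempty), {y | ∑ t, K C t * y t = 1}) ∩
        ⋂ (t) (_ : ¬ useful t), {y : Fin k → ℝ | y t = 0}) := by
      ext y
      simp [hQ]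
    rw [this]
    refine (isClosed_iInter fun t => isClosed_le continuous_const (continuous_apply t)).inter
      ((isClosed_iInter fun C => isClosed_iInter fun _ => isClosed_iInter fun _ =>
        isClosed_eq (by fun_prop) continuous_const).inter
        (isClosed_iInter fun t => isClosed_iInter fun _ =>
          isClosed_eq (continuous_apply t) continuous_const))
  have hbd : ∀ t, ∃ B : ℝ, ∀ y ∈ Q, y t ≤ B := by
    intro t
    by_cases hu : useful t
    · obtain ⟨C, h1, h2, h3⟩ := hu
      refine ⟨1 / K C t, fun y hy => ?_⟩
      have hpos : 0 < K C t := lt_of_le_of_ne (hK0 C t) (Ne.symm h3)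
      rw [le_div_iff₀ hpos, ← hy.2.1 C h1 h2, mul_comm]
      exact Finset.single_le_sum (f := fun t => K C t * y t)
        (fun i _ => mul_nonneg (hK0 C i) (hy.1 i)) (Finset.mem_univ t)
    · exact ⟨0, fun y hy => (hy.2.2 t hu).le⟩
  choose B hB using hbd
  have hcomp : IsCompact Q := by
    refine (isCompact_Icc (a := (0 : Fin k → ℝ)) (b := B)).of_isClosed_subset hclosed ?_
    intro y hy
    exact ⟨fun t => hy.1 t, fun t => hB t y hy⟩
  set π : (Fin k → ℝ) →ₗ[ℝ] (V → ℝ) :=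
    (Matrix.of fun (v : V) (t : Fin k) => (a v t : ℝ)).mulVecLin with hπ
  have hπa : ∀ y v, π y v = ∑ t, (a v t : ℝ) * y t := by
    intro y v
    simp [hπ, Matrix.mulVec, dotProduct]
  have himg : π '' Q = stab G := by
    apply Set.Subset.antisymm
    · rintro _ ⟨y, hy, rfl⟩
      refine mem_stab_of_clique G hG _ ?_ ?_
      · intro v
        rw [hπa]
        exact Finset.sum_nonneg fun t _ => mul_nonneg (by positivity) (hy.1 t)
      · intro C h1 h2
        rw [← hy.2.1 C h1 h2]
        simp only [hπa]
        rw [Finset.sum_comm]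
        refine Finset.sum_le_sum fun t _ => ?_
        rw [← Finset.sum_mul]
        refine mul_le_mul_of_nonneg_right ?_ (hy.1 t)
        simp [hK]
    · refine convexHull_min ?_ (hslice.convex.linear_image π)
      rintro _ ⟨S, hS, rfl⟩
      set S' : Stb G := ⟨S, hS⟩
      have hu0 : ∀ C : Finset V, G.IsClique (C : Set V) → C.Nonempty → ∀ t, ¬ useful t →
          K C t = 0 := by
        intro C h1 h2 t ht
        by_contra h3
        exact ht ⟨C, h1, h2, h3⟩
      refine ⟨fun t => if useful t then (f t S' : ℝ) else 0, ⟨?_, ?_, ?_⟩, ?_⟩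
      · intro t
        dsimp only
        split_ifs
        · positivity
        · exact le_rfl
      · intro C h1 h2
        have e : ∀ t, K C t * (if useful t then (f t S' : ℝ) else 0) = K C t * f t S' := by
          intro t
          split_ifs with h3
          · rfl
          · rw [hu0 C h1 h2 t h3]; simp
        simp only [e]
        simp only [hK, add_mul, Finset.sum_add_distrib, Finset.sum_mul]
        rw [Finset.sum_comm, hb' C h1 h2]
        simp only [ha']
        exact_mod_cast sum_rho_add_sig G C h1 S'
      · intro t ht
        simp [ht]
      · funext v
        rw [hπa]
        have e : ∀ t, (a v t : ℝ) * (if useful t then (f t S' : ℝ) else 0) = a v t * f t S' := by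
          intro t
          split_ifs with h3
          · rfl
          · have h4 := hu0 {v} (by simp) (by simp) t h3
            simp only [hK, Finset.sum_singleton] at h4
            have h5 : (0:ℝ) ≤ a v t := by positivity
            have h6 : (0:ℝ) ≤ b {v} t := by positivity
            have : (a v t : ℝ) = 0 := by linarith
            rw [this]; simp
        simp only [e, ha']
        by_cases hv : v ∈ S <;> simp [rho, hv, S']
  have hin : polySize Q ∈ {r : ℕ | ∃ (k : ℕ) (Q : Set (Fin k → ℝ)),
      IsExtension (stab G) Q ∧ polySize Q = r} :=
    ⟨k, Q, ⟨hslice.isPolytope hcomp, π, himg⟩, rfl⟩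
  exact (Nat.sInf_le hin).trans hslice.polySize_le


/-- Restriction of a stable set along an embedding. -/
def pull {V' V : Type} {G' : SimpleGraph V'} {G : SimpleGraph V} (e : G' ↪g G) (S : Stb G) :
    Stb G' :=
  ⟨e ⁻¹' S.1, fun u hu v hv h => S.2 (e u) hu (e v) hv (e.map_adj_iff.2 h)⟩

/-- Lifting of row functions along an embedding, with a weight. -/
def liftFn {V' V : Type} {G' : SimpleGraph V'} {G : SimpleGraph V} (e : G' ↪g G)
    (φ : Stb G → NNReal) : (Stb G' → NNReal) →ₗ[NNReal] (Stb G → NNReal) where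
  toFun f := fun S => φ S * f (pull e S)
  map_add' f g := by funext S; simp [mul_add]
  map_smul' c f := by funext S; simp; ring

theorem Cert.sig_mem {V : Type} {G : SimpleGraph V} {F : Finset (Stb G → NNReal)}
    (h : Cert G F) (C : Set V) (hC : G.IsClique C) (hne : C.Nonempty ∨ Nonempty V) :
    sig G C ∈ Submodule.span NNReal (F : Set (Stb G → NNReal)) := by
  rcases C.eq_empty_or_nonempty with rfl | hC'
  · rcases hne with h1 | ⟨⟨v⟩⟩
    · simp at h1
    · have : sig G ∅ = sig G {v} + rho G v := by
        funext S
        by_cases hv : v ∈ S.1 <;> simp [sig, rho, hv]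
      rw [this]
      exact Submodule.add_mem _ (h.2 _ (by simp) (by simp)) (h.1 v)
  · exact h.2 C hC hC'

open scoped Classical in
theorem Cert.lift_rho {V' V : Type} {G' : SimpleGraph V'} {G : SimpleGraph V} (e : G' ↪g G)
    (φ : Stb G → NNReal) {F : Finset (Stb G' → NNReal)} (h : Cert G' F) (u : V') :
    φ * rho G (e u) ∈
      Submodule.span NNReal ((F.image (liftFn e φ) : Finset _) : Set (Stb G → NNReal)) := by
  rw [Finset.coe_image, Submodule.span_image]
  exact ⟨rho G' u, h.1 u, rfl⟩

open scoped Classical in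
theorem Cert.lift_sig {V' V : Type} {G' : SimpleGraph V'} {G : SimpleGraph V} (e : G' ↪g G)
    (φ : Stb G → NNReal) {F : Finset (Stb G' → NNReal)} (h : Cert G' F) (C : Set V)
    (hC : G.IsClique C) (hne : (C ∩ Set.range e).Nonempty ∨ Nonempty V') :
    φ * sig G (C ∩ Set.range e) ∈
      Submodule.span NNReal ((F.image (liftFn e φ) : Finset _) : Set (Stb G → NNReal)) := by
  rw [Finset.coe_image, Submodule.span_image]
  refine ⟨sig G' (e ⁻¹' C), h.sig_mem _ ?_ ?_, ?_⟩
  · intro u hu v hv huv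
    exact e.map_adj_iff.1 (hC hu hv (fun h => huv (e.injective h)))
  · rcases hne with ⟨_, hx, y, rfl⟩ | h1
    · exact Or.inl ⟨y, hx⟩
    · exact Or.inr h1
  · funext S
    have : (∃ v, v ∈ e ⁻¹' C ∧ v ∈ (pull e S).1) ↔ ∃ v, v ∈ C ∩ Set.range e ∧ v ∈ S.1 := by
      constructor
      · rintro ⟨v, h1, h2⟩; exact ⟨e v, ⟨h1, v, rfl⟩, h2⟩
      · rintro ⟨_, ⟨h1, v, rfl⟩, h2⟩; exact ⟨v, h1, h2⟩
    simp only [liftFn, sig, LinearMap.coe_mk, AddHom.coe_mk, Pi.mul_apply, this]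

open scoped Classical in
theorem Cert.lift_rho_set {V : Type} {G : SimpleGraph V} (s : Set V)
    (φ : Stb G → NNReal) {F : Finset (Stb (G.induce s) → NNReal)} (h : Cert (G.induce s) F)
    (u : V) (hu : u ∈ s) :
    φ * rho G u ∈ Submodule.span NNReal
      ((F.image (liftFn (SimpleGraph.Embedding.induce s) φ) : Finset _) :
        Set (Stb G → NNReal)) :=
  h.lift_rho (SimpleGraph.Embedding.induce s) φ ⟨u, hu⟩

open scoped Classical in
theorem Cert.lift_sig_set {V : Type} {G : SimpleGraph V} (s : Set V)
    (φ : Stb G → NNReal) {F : Finset (Stb (G.induce s) → NNReal)} (h : Cert (G.induce s) F)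
    (C : Set V) (hC : G.IsClique C) (hne : (C ∩ s).Nonempty ∨ s.Nonempty) :
    φ * sig G (C ∩ s) ∈ Submodule.span NNReal
      ((F.image (liftFn (SimpleGraph.Embedding.induce s) φ) : Finset _) :
        Set (Stb G → NNReal)) := by
  have hr : Set.range (SimpleGraph.Embedding.induce (G := G) s) = s := by
    ext x
    constructor
    · rintro ⟨y, rfl⟩; exact y.2
    · intro hx; exact ⟨⟨x, hx⟩, rfl⟩
  have := h.lift_sig (SimpleGraph.Embedding.induce s) φ C hC (by
    rw [hr]
    exact hne.imp id (fun h => h.to_subtype))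
  rwa [hr] at this

/-- Invariance under isomorphism. -/
theorem HasRank.of_iso {V' V : Type} {G' : SimpleGraph V'} {G : SimpleGraph V} (e : G' ≃g G)
    {r : ℕ} (h : HasRank G' r) : HasRank G r := by
  classical
  obtain ⟨F, hF, hc⟩ := h
  refine ⟨F.image (liftFn e.toEmbedding 1), Finset.card_image_le.trans hF, ?_, ?_⟩
  · intro v
    have := hc.lift_rho e.toEmbedding 1 (e.symm v)
    simpa using this
  · intro C hC hne
    have hr : Set.range e.toEmbedding = Set.univ := Set.range_eq_univ.2 e.surjective
    have := hc.lift_sig e.toEmbedding 1 C hC (by rw [hr]; simpa using Or.inl hne)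
    rw [hr] at this
    simpa using this

open scoped Classical in
/-- Indicator of the stable sets hitting `A`. -/
noncomputable def hit {V : Type} (G : SimpleGraph V) (A : Set V) : Stb G → NNReal :=
  fun S => if ∃ v, v ∈ A ∧ v ∈ S.1 then 1 else 0

theorem span_mono' {V : Type} {G : SimpleGraph V} {F F' : Finset (Stb G → NNReal)} (h : F ⊆ F')
    {f : Stb G → NNReal} (hf : f ∈ Submodule.span NNReal (F : Set (Stb G → NNReal))) :
    f ∈ Submodule.span NNReal (F' : Set (Stb G → NNReal)) :=
  Submodule.span_mono (by exact_mod_cast h) hf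

theorem HasRank.two_join {V : Type} {G : SimpleGraph V} {V₁ V₂ : Set V} (hj : Is2Join G V₁ V₂)
    {r₁ r₂ : ℕ} (h₁ : HasRank (G.induce V₁) r₁) (h₂ : HasRank (G.induce V₂) r₂) :
    HasRank G (3 * (r₁ + r₂)) := by
  classical
  obtain ⟨hun, hdisj, A₁, B₁, A₂, B₂, hA₁, hB₁, hA₂, hB₂, -, -, -, -, hd₁, hd₂, hAA, hBB, hE⟩ := hj
  obtain ⟨F₁, hF₁, hc₁⟩ := h₁
  obtain ⟨F₂, hF₂, hc₂⟩ := h₂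
  let L₁ : (Stb G → NNReal) → Finset (Stb G → NNReal) :=
    fun φ => F₁.image (liftFn (SimpleGraph.Embedding.induce V₁) φ)
  let L₂ : (Stb G → NNReal) → Finset (Stb G → NNReal) :=
    fun φ => F₂.image (liftFn (SimpleGraph.Embedding.induce V₂) φ)
  have hL₁ : ∀ φ, (L₁ φ).card ≤ r₁ := fun φ => Finset.card_image_le.trans hF₁
  have hL₂ : ∀ φ, (L₂ φ).card ≤ r₂ := fun φ => Finset.card_image_le.trans hF₂
  have hcov : ∀ v, v ∈ V₁ ∨ v ∈ V₂ := fun v => by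
    have : v ∈ V₁ ∪ V₂ := by rw [hun]; trivial
    exact this
  -- the main identity
  have key : ∀ (A A' : Set V), A ⊆ V₁ → A' ⊆ V₂ → (∀ a ∈ A, ∀ a' ∈ A', G.Adj a a') →
      ∀ C : Set V, C ∩ V₁ ⊆ A → C ∩ V₂ ⊆ A' →
      sig G C = sig G A' * sig G (C ∩ V₁) + hit G A' * sig G (C ∩ V₂) := by
    intro A A' hA hA' hadj C h1 h2
    funext S
    simp only [Pi.add_apply, Pi.mul_apply]
    have hiff : (∃ v, v ∈ C ∧ v ∈ S.1) ↔ (∃ v, v ∈ C ∩ V₁ ∧ v ∈ S.1) ∨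
        (∃ v, v ∈ C ∩ V₂ ∧ v ∈ S.1) := by
      constructor
      · rintro ⟨v, hv, hS⟩
        rcases hcov v with h | h
        · exact Or.inl ⟨v, ⟨hv, h⟩, hS⟩
        · exact Or.inr ⟨v, ⟨hv, h⟩, hS⟩
      · rintro (⟨v, hv, hS⟩ | ⟨v, hv, hS⟩) <;> exact ⟨v, hv.1, hS⟩
    by_cases hS : ∃ v, v ∈ A' ∧ v ∈ S.1
    · have hn : ¬ ∃ v, v ∈ C ∩ V₁ ∧ v ∈ S.1 := by
        rintro ⟨v, hv, hvS⟩
        obtain ⟨a, ha, haS⟩ := hS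
        exact S.2 v hvS a haS (hadj v (h1 hv) a ha)
      simp only [sig, hit, hiff, hS, hn, false_or, if_true, if_false]
      simp
    · have hn : ¬ ∃ v, v ∈ C ∩ V₂ ∧ v ∈ S.1 := by
        rintro ⟨v, hv, hvS⟩
        exact hS ⟨v, h2 hv, hvS⟩
      simp only [sig, hit, hiff, hS, hn, or_false, if_false]
      simp
  refine ⟨(L₁ 1 ∪ L₂ 1) ∪ ((L₁ (sig G A₂) ∪ L₂ (hit G A₂)) ∪ (L₁ (sig G B₂) ∪ L₂ (hit G B₂))),
    ?_, ?_, ?_⟩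
  · have e := hL₁ 1
    have e := hL₂ 1
    have e := hL₁ (sig G A₂)
    have e := hL₂ (hit G A₂)
    have e := hL₁ (sig G B₂)
    have e := hL₂ (hit G B₂)
    have e := Finset.card_union_le (L₁ 1) (L₂ 1)
    have e := Finset.card_union_le (L₁ (sig G A₂)) (L₂ (hit G A₂))
    have e := Finset.card_union_le (L₁ (sig G B₂)) (L₂ (hit G B₂))
    have e := Finset.card_union_le (L₁ (sig G A₂) ∪ L₂ (hit G A₂)) (L₁ (sig G B₂) ∪ L₂ (hit G B₂))
    have e := Finset.card_union_le (L₁ 1 ∪ L₂ 1)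
      ((L₁ (sig G A₂) ∪ L₂ (hit G A₂)) ∪ (L₁ (sig G B₂) ∪ L₂ (hit G B₂)))
    omega
  · intro v
    rcases hcov v with h | h
    · have := hc₁.lift_rho_set V₁ 1 v h
      rw [one_mul] at this
      exact span_mono' (by intro x hx; simp only [Finset.mem_union]; exact Or.inl (Or.inl hx)) this
    · have := hc₂.lift_rho_set V₂ 1 v h
      rw [one_mul] at this
      exact span_mono' (by intro x hx; simp only [Finset.mem_union]; exact Or.inl (Or.inr hx)) this
  · intro C hC hne
    by_cases h1 : (C ∩ V₁).Nonempty
    · by_cases h2 : (C ∩ V₂).Nonempty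
      · obtain ⟨c₁, hc1, hc1'⟩ := h1
        obtain ⟨c₂, hc2, hc2'⟩ := h2
        have hadj : ∀ x ∈ C ∩ V₁, ∀ y ∈ C ∩ V₂, (x ∈ A₁ ∧ y ∈ A₂) ∨ (x ∈ B₁ ∧ y ∈ B₂) := by
          rintro x ⟨hx, hx'⟩ y ⟨hy, hy'⟩
          refine hE x hx' y hy' (hC hx hy ?_)
          rintro rfl
          exact Set.disjoint_left.1 hdisj hx' hy'
        rcases hadj c₁ ⟨hc1, hc1'⟩ c₂ ⟨hc2, hc2'⟩ with ⟨ha1, ha2⟩ | ⟨ha1, ha2⟩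
        · rw [key A₁ A₂ hA₁ hA₂ hAA C]
          · refine Submodule.add_mem _
              (span_mono' ?_ (hc₁.lift_sig_set V₁ (sig G A₂) C hC (Or.inl ⟨c₁, hc1, hc1'⟩)))
              (span_mono' ?_ (hc₂.lift_sig_set V₂ (hit G A₂) C hC (Or.inl ⟨c₂, hc2, hc2'⟩)))
            · intro x hx; simp only [Finset.mem_union]; exact Or.inr (Or.inl (Or.inl hx))
            · intro x hx; simp only [Finset.mem_union]; exact Or.inr (Or.inl (Or.inr hx))
          · intro x hx
            rcases hadj x hx c₂ ⟨hc2, hc2'⟩ with h | h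
            · exact h.1
            · exact absurd h.2 (Set.disjoint_left.1 hd₂ ha2)
          · intro y hy
            rcases hadj c₁ ⟨hc1, hc1'⟩ y hy with h | h
            · exact h.2
            · exact absurd h.1 (Set.disjoint_left.1 hd₁ ha1)
        · rw [key B₁ B₂ hB₁ hB₂ hBB C]
          · refine Submodule.add_mem _
              (span_mono' ?_ (hc₁.lift_sig_set V₁ (sig G B₂) C hC (Or.inl ⟨c₁, hc1, hc1'⟩)))
              (span_mono' ?_ (hc₂.lift_sig_set V₂ (hit G B₂) C hC (Or.inl ⟨c₂, hc2, hc2'⟩)))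
            · intro x hx; simp only [Finset.mem_union]; exact Or.inr (Or.inr (Or.inl hx))
            · intro x hx; simp only [Finset.mem_union]; exact Or.inr (Or.inr (Or.inr hx))
          · intro x hx
            rcases hadj x hx c₂ ⟨hc2, hc2'⟩ with h | h
            · exact absurd ha2 (Set.disjoint_left.1 hd₂ h.2)
            · exact h.1
          · intro y hy
            rcases hadj c₁ ⟨hc1, hc1'⟩ y hy with h | h
            · exact absurd ha1 (Set.disjoint_left.1 hd₁ h.1)
            · exact h.2
      · have hCV : C ∩ V₁ = C := by
          refine Set.inter_eq_left.2 fun x hx => ?_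
          rcases hcov x with h | h
          · exact h
          · exact absurd ⟨x, hx, h⟩ h2
        have := hc₁.lift_sig_set V₁ 1 C hC (Or.inl h1)
        rw [one_mul, hCV] at this
        exact span_mono' (by intro x hx; simp only [Finset.mem_union]; exact Or.inl (Or.inl hx)) this
    · have hCV : C ∩ V₂ = C := by
        refine Set.inter_eq_left.2 fun x hx => ?_
        rcases hcov x with h | h
        · exact absurd ⟨x, hx, h⟩ h1
        · exact h
      have := hc₂.lift_sig_set V₂ 1 C hC (Or.inl (by rwa [hCV]))
      rw [one_mul, hCV] at this
      exact span_mono' (by intro x hx; simp only [Finset.mem_union]; exact Or.inl (Or.inr hx)) this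

theorem HasRank.skew {V : Type} {G : SimpleGraph V} {A₁ B₁ A₂ B₂ : Set V}
    (hs : IsSkewPartition G A₁ B₁ A₂ B₂) {r₁ r₂ r₃ r₄ : ℕ}
    (h₁ : HasRank (G.induce (A₁ ∪ B₁)) r₁) (h₂ : HasRank (G.induce (A₂ ∪ B₂)) r₂)
    (h₃ : HasRank (G.induce (A₁ ∪ B₂)) r₃) (h₄ : HasRank (G.induce (A₂ ∪ B₁)) r₄) :
    HasRank G (r₁ + r₂ + r₃ + r₄) := by
  classical
  obtain ⟨nA₁, nB₁, nA₂, nB₂, hun, -, hAd, -, -, hBd, -, hAA, hBB⟩ := hs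
  obtain ⟨F₁, hF₁, hc₁⟩ := h₁
  obtain ⟨F₂, hF₂, hc₂⟩ := h₂
  obtain ⟨F₃, hF₃, hc₃⟩ := h₃
  obtain ⟨F₄, hF₄, hc₄⟩ := h₄
  have hcov : ∀ v, v ∈ A₁ ∨ v ∈ B₁ ∨ v ∈ A₂ ∨ v ∈ B₂ := fun v => by
    have : v ∈ A₁ ∪ B₁ ∪ A₂ ∪ B₂ := by rw [hun]; trivial
    simp only [Set.mem_union] at this
    tauto
  have hhs : hit G A₁ + sig G A₁ = 1 := by
    funext S
    by_cases h : ∃ v, v ∈ A₁ ∧ v ∈ S.1 <;> simp [hit, sig, h]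
  have key : ∀ (B : Set V) (C : Set V), (∀ v ∈ C, v ∈ A₁ ∨ v ∈ A₂ ∨ v ∈ B) →
      sig G C = hit G A₁ * sig G (C ∩ (A₁ ∪ B)) + sig G A₁ * sig G (C ∩ (A₂ ∪ B)) := by
    intro B C hCB
    funext S
    simp only [Pi.add_apply, Pi.mul_apply]
    by_cases hS : ∃ v, v ∈ A₁ ∧ v ∈ S.1
    · have hiff : (∃ v, v ∈ C ∧ v ∈ S.1) ↔ (∃ v, v ∈ C ∩ (A₁ ∪ B) ∧ v ∈ S.1) := by
        constructor
        · rintro ⟨v, hv, hvS⟩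
          refine ⟨v, ⟨hv, ?_⟩, hvS⟩
          rcases hCB v hv with h | h | h
          · exact Or.inl h
          · obtain ⟨a, ha, haS⟩ := hS
            exact absurd (hAA a ha v h) (S.2 a haS v hvS)
          · exact Or.inr h
        · rintro ⟨v, hv, hS⟩; exact ⟨v, hv.1, hS⟩
      simp only [sig, hit, hiff, hS, if_true]
      simp
    · have hiff : (∃ v, v ∈ C ∧ v ∈ S.1) ↔ (∃ v, v ∈ C ∩ (A₂ ∪ B) ∧ v ∈ S.1) := by
        constructor
        · rintro ⟨v, hv, hvS⟩
          refine ⟨v, ⟨hv, ?_⟩, hvS⟩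
          rcases hCB v hv with h | h | h
          · exact absurd ⟨v, h, hvS⟩ hS
          · exact Or.inl h
          · exact Or.inr h
        · rintro ⟨v, hv, hS⟩; exact ⟨v, hv.1, hS⟩
      simp only [sig, hit, hiff, hS, if_false]
      simp
  have hr1 : ∀ v ∈ A₁, hit G A₁ * rho G v = rho G v := by
    intro v hv
    funext S
    by_cases h : v ∈ S.1
    · have : ∃ v, v ∈ A₁ ∧ v ∈ S.1 := ⟨v, hv, h⟩
      simp [hit, this]
    · simp [rho, h]
  have hr2 : ∀ v ∈ A₂, sig G A₁ * rho G v = rho G v := by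
    intro v hv
    funext S
    by_cases h : v ∈ S.1
    · have : ¬ ∃ v, v ∈ A₁ ∧ v ∈ S.1 := by
        rintro ⟨a, ha, haS⟩
        exact S.2 a haS v h (hAA a ha v hv)
      simp only [Pi.mul_apply, sig, this, if_false, one_mul]
    · simp [rho, h]
  have hr3 : ∀ v, rho G v = hit G A₁ * rho G v + sig G A₁ * rho G v := by
    intro v; rw [← add_mul, hhs, one_mul]
  let L₁ := F₁.image (liftFn (SimpleGraph.Embedding.induce (A₁ ∪ B₁)) (hit G A₁))
  let L₂ := F₂.image (liftFn (SimpleGraph.Embedding.induce (A₂ ∪ B₂)) (sig G A₁))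
  let L₃ := F₃.image (liftFn (SimpleGraph.Embedding.induce (A₁ ∪ B₂)) (hit G A₁))
  let L₄ := F₄.image (liftFn (SimpleGraph.Embedding.induce (A₂ ∪ B₁)) (sig G A₁))
  have s1 : L₁ ⊆ L₁ ∪ L₂ ∪ L₃ ∪ L₄ := by
    intro x hx; simp only [Finset.mem_union]; tauto
  have s2 : L₂ ⊆ L₁ ∪ L₂ ∪ L₃ ∪ L₄ := by
    intro x hx; simp only [Finset.mem_union]; tauto
  have s3 : L₃ ⊆ L₁ ∪ L₂ ∪ L₃ ∪ L₄ := by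
    intro x hx; simp only [Finset.mem_union]; tauto
  have s4 : L₄ ⊆ L₁ ∪ L₂ ∪ L₃ ∪ L₄ := by
    intro x hx; simp only [Finset.mem_union]; tauto
  refine ⟨L₁ ∪ L₂ ∪ L₃ ∪ L₄, ?_, ?_, ?_⟩
  · have e : L₁.card ≤ r₁ := Finset.card_image_le.trans hF₁
    have e : L₂.card ≤ r₂ := Finset.card_image_le.trans hF₂
    have e : L₃.card ≤ r₃ := Finset.card_image_le.trans hF₃
    have e : L₄.card ≤ r₄ := Finset.card_image_le.trans hF₄
    have e := Finset.card_union_le L₁ L₂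
    have e := Finset.card_union_le (L₁ ∪ L₂) L₃
    have e := Finset.card_union_le (L₁ ∪ L₂ ∪ L₃) L₄
    omega
  · intro v
    rcases hcov v with h | h | h | h
    · rw [← hr1 v h]
      exact span_mono' s1 (hc₁.lift_rho_set _ _ v (Or.inl h))
    · rw [hr3 v]
      exact Submodule.add_mem _ (span_mono' s1 (hc₁.lift_rho_set _ _ v (Or.inr h)))
        (span_mono' s4 (hc₄.lift_rho_set _ _ v (Or.inr h)))
    · rw [← hr2 v h]
      exact span_mono' s2 (hc₂.lift_rho_set _ _ v (Or.inl h))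
    · rw [hr3 v]
      exact Submodule.add_mem _ (span_mono' s3 (hc₃.lift_rho_set _ _ v (Or.inr h)))
        (span_mono' s2 (hc₂.lift_rho_set _ _ v (Or.inr h)))
  · intro C hC _
    by_cases hB : (C ∩ B₁).Nonempty
    · rw [key B₁ C]
      · exact Submodule.add_mem _
          (span_mono' s1 (hc₁.lift_sig_set _ _ C hC (Or.inr (nA₁.mono Set.subset_union_left))))
          (span_mono' s4 (hc₄.lift_sig_set _ _ C hC (Or.inr (nA₂.mono Set.subset_union_left))))
      · intro v hv
        rcases hcov v with h | h | h | h
        · exact Or.inl h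
        · exact Or.inr (Or.inr h)
        · exact Or.inr (Or.inl h)
        · obtain ⟨b, hb, hb'⟩ := hB
          refine absurd (hC hb hv ?_) (hBB b hb' v h)
          rintro rfl
          exact Set.disjoint_left.1 hBd hb' h
    · rw [key B₂ C]
      · exact Submodule.add_mem _
          (span_mono' s3 (hc₃.lift_sig_set _ _ C hC (Or.inr (nA₁.mono Set.subset_union_left))))
          (span_mono' s2 (hc₂.lift_sig_set _ _ C hC (Or.inr (nA₂.mono Set.subset_union_left))))
      · intro v hv
        rcases hcov v with h | h | h | h
        · exact Or.inl h
        · exact absurd ⟨v, hv, h⟩ hB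
        · exact Or.inr (Or.inl h)
        · exact Or.inr (Or.inr h)


theorem HasRank.mono {V : Type} {G : SimpleGraph V} {r r' : ℕ} (h : HasRank G r) (hr : r ≤ r') :
    HasRank G r' := by
  obtain ⟨F, h1, h2⟩ := h
  exact ⟨F, h1.trans hr, h2⟩

/-- Number of ordered adjacent pairs. -/
noncomputable def mm {V : Type} (G : SimpleGraph V) : ℕ :=
  Nat.card {p : V × V // G.Adj p.1 p.2}

theorem sig_eq_of_subset {V : Type} (G : SimpleGraph V) (C K : Finset V) (hCK : C ⊆ K)
    (hK : G.IsClique (K : Set V)) [DecidableEq V] :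
    sig G C = sig G K + ∑ v ∈ K \ C, rho G v := by
  funext S
  have h1 := sum_rho_add_sig G K hK S
  have h2 := sum_rho_add_sig G C (hK.subset (by exact_mod_cast hCK)) S
  rw [← Finset.sum_sdiff hCK, ← h2] at h1
  rw [Pi.add_apply, Finset.sum_apply]
  have : ∑ v ∈ C, rho G v S + (sig G K S + ∑ v ∈ K \ C, rho G v S) =
      ∑ v ∈ C, rho G v S + sig G C S := by
    rw [← h1]; ring
  exact (add_left_cancel this).symm

theorem hasRank_cover {V : Type} [Fintype V] (G : SimpleGraph V) {ι : Type} [Fintype ι]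
    (K : ι → Set V) (hK : ∀ i, G.IsClique (K i))
    (hcov : ∀ C : Set V, G.IsClique C → C.Nontrivial → ∃ i, C ⊆ K i) :
    HasRank G (2 * Fintype.card V + Fintype.card ι) := by
  classical
  let R : Finset (Stb G → NNReal) := Finset.univ.image (rho G)
  let R' : Finset (Stb G → NNReal) := Finset.univ.image fun v => sig G {v}
  let T : Finset (Stb G → NNReal) := Finset.univ.image fun i => sig G (K i)
  have hrho : ∀ v, rho G v ∈ Submodule.span NNReal
      ((R ∪ R' ∪ T : Finset _) : Set (Stb G → NNReal)) := by
    intro v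
    apply Submodule.subset_span
    simp only [Finset.coe_union]
    exact Or.inl (Or.inl (by simp [R]))
  refine ⟨R ∪ R' ∪ T, ?_, hrho, ?_⟩
  · have e : R.card ≤ Fintype.card V := Finset.card_image_le
    have e : R'.card ≤ Fintype.card V := Finset.card_image_le
    have e : T.card ≤ Fintype.card ι := Finset.card_image_le
    have e := Finset.card_union_le R R'
    have e := Finset.card_union_le (R ∪ R') T
    omega
  · intro C hC hne
    rcases Set.subsingleton_or_nontrivial C with hs | hn
    · obtain ⟨v, hv⟩ := hne
      have : C = {v} := Set.Subsingleton.eq_singleton_of_mem hs hv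
      rw [this]
      apply Submodule.subset_span
      simp only [Finset.coe_union]
      exact Or.inl (Or.inr (by simp [R']))
    · obtain ⟨i, hi⟩ := hcov C hC hn
      have := sig_eq_of_subset G C.toFinset (K i).toFinset (by simpa using hi)
        (by simpa using hK i)
      simp only [Set.coe_toFinset] at this
      rw [this]
      refine Submodule.add_mem _ ?_ (Submodule.sum_mem _ fun v _ => hrho v)
      apply Submodule.subset_span
      simp only [Finset.coe_union]
      exact Or.inr (by simp [T])

theorem hasRank_diamondFree {V : Type} [Fintype V] (G : SimpleGraph V)
    (h : ∀ u v x y, G.Adj u v → G.Adj u x → G.Adj v x → G.Adj u y → G.Adj v y → x ≠ y →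
      G.Adj x y) :
    HasRank G (2 * Fintype.card V + mm G) := by
  classical
  have := hasRank_cover G (ι := {p : V × V // G.Adj p.1 p.2})
    (fun p => {x | x = p.1.1 ∨ x = p.1.2 ∨ (G.Adj p.1.1 x ∧ G.Adj p.1.2 x)}) ?_ ?_
  · unfold mm
    rwa [Nat.card_eq_fintype_card]
  · rintro ⟨⟨u, v⟩, huv⟩ x hx y hy hxy
    simp only [Set.mem_ofPred_eq] at hx hy
    simp only at huv
    have huv' := huv.symm
    rcases hx with rfl | rfl | ⟨hx1, hx2⟩ <;> rcases hy with rfl | rfl | ⟨hy1, hy2⟩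
    · exact absurd rfl hxy
    · exact huv
    · exact hy1
    · exact huv'
    · exact absurd rfl hxy
    · exact hy2
    · exact hx1.symm
    · exact hx2.symm
    · exact h u v x y huv hx1 hx2 hy1 hy2 hxy
  · rintro C hC ⟨u, hu, v, hv, huv⟩
    refine ⟨⟨(u, v), hC hu hv huv⟩, fun x hx => ?_⟩
    by_cases h1 : x = u
    · exact Or.inl h1
    by_cases h2 : x = v
    · exact Or.inr (Or.inl h2)
    exact Or.inr (Or.inr ⟨hC hu hx (Ne.symm h1), hC hv hx (Ne.symm h2)⟩)

theorem hasRank_bipartite {V : Type} [Fintype V] (G : SimpleGraph V) (h : IsBipartite G) :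
    HasRank G (2 * Fintype.card V + mm G) := by
  obtain ⟨s, hs⟩ := h
  refine hasRank_diamondFree G ?_
  intro u v x y h1 h2 h3
  have a1 := hs h1
  have a2 := hs h2
  have a3 := hs h3
  tauto

theorem lineGraph_coords {W : Type} (H : SimpleGraph W) (h : IsBipartite H) :
    ∃ α β : H.edgeSet → W, (∀ e f, α e = α f → β e = β f → e = f) ∧
      ∀ e f, (lineGraph H).Adj e f ↔ e ≠ f ∧ (α e = α f ∨ β e = β f) := by
  obtain ⟨s, hs⟩ := h
  have hex : ∀ e : H.edgeSet, ∃ a b, a ∈ s ∧ b ∉ s ∧ (e : Sym2 W) = s(a, b) := by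
    rintro ⟨e, he⟩
    induction e using Sym2.ind with
    | _ x y =>
      have := hs (show H.Adj x y from he)
      by_cases hx : x ∈ s
      · exact ⟨x, y, hx, this.1 hx, rfl⟩
      · refine ⟨y, x, ?_, hx, Sym2.eq_swap⟩
        by_contra hy
        exact hx (this.2 hy)
  choose α β hα hβ he using hex
  refine ⟨α, β, ?_, ?_⟩
  · intro e f h1 h2
    apply Subtype.ext
    rw [he e, he f, h1, h2]
  · intro e f
    unfold lineGraph
    rw [SimpleGraph.fromRel_adj]
    refine and_congr_right fun _ => ?_
    have hsym : (∃ v, v ∈ (e : Sym2 W) ∧ v ∈ (f : Sym2 W)) ↔ (α e = α f ∨ β e = β f) := by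
      rw [he e, he f]
      simp only [Sym2.mem_iff]
      have h1 := hα e
      have h2 := hα f
      have h3 := hβ e
      have h4 := hβ f
      constructor
      · rintro ⟨v, rfl | rfl, h | h⟩
        · exact Or.inl h
        · rw [h] at h1; exact absurd h1 h4
        · rw [h] at h3; exact absurd h2 h3
        · exact Or.inr h
      · rintro (h | h)
        · exact ⟨α e, Or.inl rfl, Or.inl h⟩
        · exact ⟨β e, Or.inr rfl, Or.inr h⟩
    have hsym' : (∃ v, v ∈ (f : Sym2 W) ∧ v ∈ (e : Sym2 W)) ↔
        (∃ v, v ∈ (e : Sym2 W) ∧ v ∈ (f : Sym2 W)) := by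
      simp only [and_comm]
    rw [hsym', or_self, hsym]

theorem hasRank_line {V : Type} [Fintype V] (G : SimpleGraph V) {W : Type} (α β : V → W)
    (hinj : ∀ u v, α u = α v → β u = β v → u = v)
    (hadj : ∀ u v, G.Adj u v ↔ u ≠ v ∧ (α u = α v ∨ β u = β v)) :
    HasRank G (2 * Fintype.card V + mm G) := by
  refine hasRank_diamondFree G ?_
  intro u v x y
  simp only [hadj]
  have := hinj u v
  have := hinj u x
  have := hinj u y
  have := hinj v x
  have := hinj v y
  grind

theorem hasRank_columns {V : Type} (G : SimpleGraph V) [Fintype (Stb G)] :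
    HasRank G (Fintype.card (Stb G)) := by
  classical
  let F : Finset (Stb G → NNReal) := Finset.univ.image fun S => Pi.single S 1
  have h : ∀ f : Stb G → NNReal, f ∈ Submodule.span NNReal (F : Set (Stb G → NNReal)) := by
    intro f
    have : f = ∑ S, f S • (Pi.single S 1 : Stb G → NNReal) := by
      funext S
      rw [Finset.sum_apply, Finset.sum_eq_single S]
      · simp
      · intro T _ hT
        simp [Pi.single_apply, hT.symm]
      · simp
    rw [this]
    exact Submodule.sum_mem _ fun S _ => Submodule.smul_mem _ _
      (Submodule.subset_span (by simp [F]))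
  exact ⟨F, Finset.card_image_le, fun v => h _, fun C _ _ => h _⟩

theorem mm_eq {V : Type} [Fintype V] [DecidableEq V] (G : SimpleGraph V) [DecidableRel G.Adj] :
    mm G = (Finset.univ.filter fun p : V × V => G.Adj p.1 p.2).card := by
  unfold mm
  rw [Nat.card_eq_fintype_card, Fintype.card_subtype]

theorem hasRank_cobipartite {V : Type} [Fintype V] (G : SimpleGraph V) (h : IsBipartite Gᶜ) :
    HasRank G (2 * Fintype.card V + mm G) := by
  classical
  obtain ⟨s, hs⟩ := h
  rcases isEmpty_or_nonempty V with hV | hV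
  · exact ⟨∅, by simp, fun v => (hV.false v).elim, fun C _ ⟨v, _⟩ => (hV.false v).elim⟩
  haveI : Fintype (Stb G) := by unfold Stb; infer_instance
  refine (hasRank_columns G).mono ?_
  have hs' : ∀ u v, u ≠ v → ¬ G.Adj u v → (u ∈ s ↔ v ∉ s) := fun u v h1 h2 =>
    hs ((SimpleGraph.compl_adj G u v).2 ⟨h1, h2⟩)
  have hex : ∀ S : Stb G, ∃ o : Option s × Option (sᶜ : Set V),
      S.1 = {v | (∃ h, o.1 = some ⟨v, h⟩) ∨ ∃ h, o.2 = some ⟨v, h⟩} := by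
    intro S
    have h1 : ∃ o : Option s, ∀ v, (∃ h, o = some ⟨v, h⟩) ↔ v ∈ S.1 ∧ v ∈ s := by
      by_cases he : ∃ v, v ∈ S.1 ∧ v ∈ s
      · obtain ⟨v, hv, hvs⟩ := he
        refine ⟨some ⟨v, hvs⟩, fun u => ?_⟩
        simp only [Option.some.injEq, Subtype.mk.injEq]
        constructor
        · rintro ⟨h, rfl⟩; exact ⟨hv, hvs⟩
        · rintro ⟨h1, h2⟩
          refine ⟨h2, ?_⟩
          by_contra hne
          exact (hs' v u hne (S.2 v hv u h1)).1 hvs h2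
      · refine ⟨none, fun u => ?_⟩
        simp only [reduceCtorEq, exists_false, false_iff]
        exact fun h => he ⟨u, h⟩
    have h2 : ∃ o : Option (sᶜ : Set V), ∀ v, (∃ h, o = some ⟨v, h⟩) ↔ v ∈ S.1 ∧ v ∉ s := by
      by_cases he : ∃ v, v ∈ S.1 ∧ v ∉ s
      · obtain ⟨v, hv, hvs⟩ := he
        refine ⟨some ⟨v, hvs⟩, fun u => ?_⟩
        simp only [Option.some.injEq, Subtype.mk.injEq]
        constructor
        · rintro ⟨h, rfl⟩; exact ⟨hv, hvs⟩
        · rintro ⟨h1, h2⟩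
          refine ⟨h2, ?_⟩
          by_contra hne
          exact hvs ((hs' v u hne (S.2 v hv u h1)).2 h2)
      · refine ⟨none, fun u => ?_⟩
        simp only [reduceCtorEq, exists_false, false_iff]
        exact fun h => he ⟨u, h⟩
    obtain ⟨o1, ho1⟩ := h1
    obtain ⟨o2, ho2⟩ := h2
    refine ⟨(o1, o2), ?_⟩
    ext v
    simp only [Set.mem_ofPred_eq, ho1, ho2]
    tauto
  choose o ho using hex
  have hinj : Function.Injective o := by
    intro S T hST
    apply Subtype.ext
    rw [ho S, ho T, hST]
  have h1 := Fintype.card_le_of_injective o hinj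
  rw [Fintype.card_prod, Fintype.card_option, Fintype.card_option] at h1
  have h2 : s.toFinset.offDiag.card + s.toFinsetᶜ.offDiag.card ≤ mm G := by
    rw [mm_eq, ← Finset.card_union_of_disjoint]
    · apply Finset.card_le_card
      rintro ⟨u, v⟩ huv
      simp only [Finset.mem_union, Finset.mem_offDiag, Set.mem_toFinset, Finset.mem_compl] at huv
      simp only [Finset.mem_filter, Finset.mem_univ, true_and]
      by_contra hn
      rcases huv with ⟨a, b, c⟩ | ⟨a, b, c⟩
      · exact (hs' u v c hn).1 a b
      · exact a ((hs' u v c hn).2 b)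
    · rw [Finset.disjoint_left]
      rintro ⟨u, v⟩ h1 h2
      simp only [Finset.mem_offDiag, Set.mem_toFinset, Finset.mem_compl] at h1 h2
      exact h2.1 h1.1
  rw [Finset.offDiag_card, Finset.offDiag_card] at h2
  have ha : s.toFinset.card = Fintype.card s := Set.toFinset_card s
  have hb : s.toFinsetᶜ.card = Fintype.card (sᶜ : Set V) := by
    rw [← Set.toFinset_compl, Set.toFinset_card]
  have hab : Fintype.card s + Fintype.card (sᶜ : Set V) = Fintype.card V := by
    have := Finset.card_add_card_compl s.toFinset
    rw [ha, hb] at this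
    exact this
  rw [ha, hb] at h2
  have hpos : 0 < Fintype.card V := Fintype.card_pos
  generalize Fintype.card s = a at *
  generalize Fintype.card (sᶜ : Set V) = b at *
  have h3 : a * a - a + a = a * a := Nat.sub_add_cancel (Nat.le_mul_self a)
  have h4 : b * b - b + b = b * b := Nat.sub_add_cancel (Nat.le_mul_self b)
  refine h1.trans ?_
  have h5 : 1 + a * b ≤ a * a + b * b := by
    rcases Nat.lt_trichotomy a b with h | h | h
    · nlinarith
    · subst h; nlinarith
    · nlinarith
  nlinarith



theorem hasRank_fib {V : Type} [Fintype V] (G : SimpleGraph V) {ι : Type} [Fintype ι]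
    (fib : ι → Set V) (hfib : ∀ i, ∀ u ∈ fib i, ∀ v ∈ fib i, ¬ G.Adj u v)
    (hS : ∀ S : Stb G, (∃ i, S.1 ⊆ fib i) ∨ ∃ u, S.1 = {u}) :
    HasRank G (2 * Fintype.card V + Fintype.card ι) := by
  classical
  have hk : ∀ S : Stb G, ∃ o : Option ι, (∀ i, o = some i → S.1 ⊆ fib i) ∧
      (o = none → ∃ u, S.1 = {u} ∧ ∀ i, u ∉ fib i) := by
    intro S
    by_cases h : ∃ i, S.1 ⊆ fib i
    · obtain ⟨i, hi⟩ := h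
      refine ⟨some i, ?_, by simp⟩
      intro j hj
      cases hj
      exact hi
    · obtain ⟨u, hu⟩ := (hS S).resolve_left h
      refine ⟨none, by simp, fun _ => ⟨u, hu, fun i hi => h ⟨i, ?_⟩⟩⟩
      rw [hu]
      simpa using hi
  choose κ hκ1 hκ2 using hk
  let kap : ι → Stb G → NNReal := fun i S => if κ S = some i then 1 else 0
  let tau : V → Stb G → NNReal := fun v S =>
    if ∃ i, κ S = some i ∧ v ∈ fib i ∧ v ∉ S.1 then 1 else 0
  let R : Finset (Stb G → NNReal) := Finset.univ.image (rho G)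
  let R' : Finset (Stb G → NNReal) := Finset.univ.image tau
  let T : Finset (Stb G → NNReal) := Finset.univ.image kap
  have hrho : ∀ v, rho G v ∈ Submodule.span NNReal
      ((R ∪ R' ∪ T : Finset _) : Set (Stb G → NNReal)) := by
    intro v
    apply Submodule.subset_span
    simp only [Finset.coe_union]
    exact Or.inl (Or.inl (by simp [R]))
  have htau : ∀ v, tau v ∈ Submodule.span NNReal
      ((R ∪ R' ∪ T : Finset _) : Set (Stb G → NNReal)) := by
    intro v
    apply Submodule.subset_span
    simp only [Finset.coe_union]
    exact Or.inl (Or.inr (by simp [R']))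
  have hkap : ∀ v, kap v ∈ Submodule.span NNReal
      ((R ∪ R' ∪ T : Finset _) : Set (Stb G → NNReal)) := by
    intro v
    apply Submodule.subset_span
    simp only [Finset.coe_union]
    exact Or.inr (by simp [T])
  refine ⟨R ∪ R' ∪ T, ?_, hrho, ?_⟩
  · have e : R.card ≤ Fintype.card V := Finset.card_image_le
    have e : R'.card ≤ Fintype.card V := Finset.card_image_le
    have e : T.card ≤ Fintype.card ι := Finset.card_image_le
    have e := Finset.card_union_le R R'
    have e := Finset.card_union_le (R ∪ R') T
    omega
  · intro C hC _
    have hid : sig G C = ∑ i with C ∩ fib i = ∅, kap i + ∑ v with v ∈ C, tau v +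
        ∑ u with u ∉ C ∧ ∀ i, u ∉ fib i, rho G u := by
      funext S
      simp only [Pi.add_apply, Finset.sum_apply]
      rcases hκ : κ S with _ | w
      · obtain ⟨u, hu, hui⟩ := hκ2 S hκ
        have e1 : ∑ i with C ∩ fib i = ∅, kap i S = 0 :=
          Finset.sum_eq_zero fun i _ => by simp [kap, hκ]
        have e2 : ∑ v with v ∈ C, tau v S = 0 :=
          Finset.sum_eq_zero fun i _ => by simp [tau, hκ]
        rw [e1, e2, zero_add, zero_add]
        have e3 : ∀ x, rho G x S = if x = u then 1 else 0 := fun x => by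
          simp [rho, hu]
        simp only [e3, Finset.sum_ite_eq', Finset.mem_filter, Finset.mem_univ, true_and]
        simp only [sig, hu, Set.mem_singleton_iff, exists_eq_right]
        by_cases huC : u ∈ C <;> simp [huC, hui]
      · have hSw := hκ1 S w hκ
        have e1 : ∑ i with C ∩ fib i = ∅, kap i S = if C ∩ fib w = ∅ then 1 else 0 := by
          have : ∀ i, kap i S = if w = i then 1 else 0 := fun i => by simp [kap, hκ]
          simp only [this, Finset.sum_ite_eq, Finset.mem_filter, Finset.mem_univ, true_and]
        have e3 : ∑ u with u ∉ C ∧ ∀ i, u ∉ fib i, rho G u S = 0 := by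
          refine Finset.sum_eq_zero fun u hu => ?_
          simp only [Finset.mem_filter, Finset.mem_univ, true_and] at hu
          have : u ∉ S.1 := fun h => hu.2 w (hSw h)
          simp [rho, this]
        have e2 : ∀ v, tau v S = if v ∈ fib w ∧ v ∉ S.1 then 1 else 0 := fun v => by
          simp [tau, hκ]
        rw [e1, e3, add_zero]
        simp only [e2]
        by_cases hCw : C ∩ fib w = ∅
        · have hd : ∀ v, v ∈ C → v ∉ fib w := fun v h1 h2 => by
            have : v ∈ C ∩ fib w := ⟨h1, h2⟩
            rw [hCw] at this
            exact this
          rw [if_pos hCw, Finset.sum_eq_zero, add_zero]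
          · have : ¬ ∃ v, v ∈ C ∧ v ∈ S.1 := fun ⟨v, h1, h2⟩ => hd v h1 (hSw h2)
            simp [sig, this]
          · intro v hv
            simp only [Finset.mem_filter, Finset.mem_univ, true_and] at hv
            simp [hd v hv]
        · obtain ⟨x, hxC, hxw⟩ := Set.nonempty_iff_ne_empty.2 hCw
          have hux : ∀ y, y ∈ C → y ∈ fib w → y = x := by
            intro y h1 h2
            by_contra hne
            exact hfib w y h2 x hxw (hC h1 hxC hne)
          rw [if_neg hCw, zero_add, Finset.sum_eq_single x]
          · have : (∃ v, v ∈ C ∧ v ∈ S.1) ↔ x ∈ S.1 := by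
              constructor
              · rintro ⟨v, h1, h2⟩
                rwa [← hux v h1 (hSw h2)]
              · exact fun h => ⟨x, hxC, h⟩
            by_cases hx : x ∈ S.1 <;> simp [sig, this, hx, hxw]
          · intro v hv hne
            simp only [Finset.mem_filter, Finset.mem_univ, true_and] at hv
            have : v ∉ fib w := fun h => hne (hux v hv h)
            simp [this]
          · intro h
            simp [hxC] at h
    rw [hid]
    exact Submodule.add_mem _ (Submodule.add_mem _ (Submodule.sum_mem _ fun v _ => hkap v)
      (Submodule.sum_mem _ fun v _ => htau v)) (Submodule.sum_mem _ fun v _ => hrho v)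

theorem coline_count {V : Type} [Fintype V] [DecidableEq V] (G : SimpleGraph V)
    {W : Type} [DecidableEq W] (α β : V → W)
    (hinj : ∀ u v, α u = α v → β u = β v → u = v)
    (hadj : ∀ u v, u ≠ v → (¬ G.Adj u v ↔ (α u = α v ∨ β u = β v)))
    (hedge : ∃ u v, G.Adj u v) (A : Finset W)
    (hA : ∀ w ∈ A, ∃ u v, u ≠ v ∧ α u = w ∧ α v = w) : 2 * A.card ≤ mm G := by
  classical
  rcases A.eq_empty_or_nonempty with rfl | ⟨w0, hw0⟩
  · simp
  have h2 : 2 ≤ mm G := by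
    obtain ⟨u, v, huv⟩ := hedge
    rw [mm_eq, ← Finset.card_pair (a := (u, v)) (b := (v, u))
      (fun h => huv.ne (Prod.ext_iff.1 h).1)]
    apply Finset.card_le_card
    intro x hx
    simp only [Finset.mem_insert, Finset.mem_singleton] at hx
    rcases hx with rfl | rfl
    · simpa using huv
    · simpa using huv.symm
  have hg : ∀ v, ∃ x, α v ≠ w0 → α x = w0 ∧ G.Adj v x := by
    intro v
    by_cases hv : α v = w0
    · exact ⟨v, fun h => absurd hv h⟩
    obtain ⟨x, y, hxy, hx, hy⟩ := hA w0 hw0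
    by_cases h1 : G.Adj v x
    · exact ⟨x, fun _ => ⟨hx, h1⟩⟩
    by_cases h2 : G.Adj v y
    · exact ⟨y, fun _ => ⟨hy, h2⟩⟩
    exfalso
    have hvx : v ≠ x := by rintro rfl; exact hv hx
    have hvy : v ≠ y := by rintro rfl; exact hv hy
    have b1 := ((hadj v x hvx).1 h1).resolve_left (by rw [hx]; exact hv)
    have b2 := ((hadj v y hvy).1 h2).resolve_left (by rw [hy]; exact hv)
    exact hxy (hinj x y (hx.trans hy.symm) (b1.symm.trans b2))
  choose g hg using hg
  let Kc : Finset V := Finset.univ.filter fun v => α v ≠ w0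
  have hKc : ∀ v, v ∈ Kc ↔ α v ≠ w0 := fun v => by simp [Kc]
  have c1 : 2 * Kc.card ≤ mm G := by
    have d1 : (Kc.image fun v => (v, g v)).card = Kc.card :=
      Finset.card_image_of_injective _ fun x y h => (Prod.ext_iff.1 h).1
    have d2 : (Kc.image fun v => (g v, v)).card = Kc.card :=
      Finset.card_image_of_injective _ fun x y h => (Prod.ext_iff.1 h).2
    have d3 : Disjoint (Kc.image fun v => (v, g v)) (Kc.image fun v => (g v, v)) := by
      rw [Finset.disjoint_left]
      intro x hx hy
      obtain ⟨a, ha, rfl⟩ := Finset.mem_image.1 hx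
      obtain ⟨b, hb, hab⟩ := Finset.mem_image.1 hy
      have : g b = a := (Prod.ext_iff.1 hab).1
      rw [hKc] at ha hb
      exact ha (this ▸ (hg b hb).1)
    rw [two_mul, mm_eq]
    nth_rw 1 [← d1]
    rw [← d2, ← Finset.card_union_of_disjoint d3]
    apply Finset.card_le_card
    intro x hx
    rcases Finset.mem_union.1 hx with hx | hx <;> obtain ⟨a, ha, rfl⟩ := Finset.mem_image.1 hx
    · simpa using (hg a ((hKc a).1 ha)).2
    · simpa using (hg a ((hKc a).1 ha)).2.symm
  have c2 : 2 * (A.card - 1) ≤ Kc.card := by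
    rw [← Finset.card_erase_of_mem hw0]
    haveI : Nonempty V := ⟨(hA w0 hw0).choose⟩
    choose! x y hxy hx hy using hA
    have hm : ∀ w ∈ A.erase w0, w ∈ A := fun w h => Finset.mem_of_mem_erase h
    have d1 : ((A.erase w0).image x).card = (A.erase w0).card := by
      apply Finset.card_image_of_injOn
      intro a ha b hb hab
      rw [← hx a (hm a ha), ← hx b (hm b hb), hab]
    have d2 : ((A.erase w0).image y).card = (A.erase w0).card := by
      apply Finset.card_image_of_injOn
      intro a ha b hb hab
      rw [← hy a (hm a ha), ← hy b (hm b hb), hab]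
    have d3 : Disjoint ((A.erase w0).image x) ((A.erase w0).image y) := by
      rw [Finset.disjoint_left]
      intro z hz hz'
      obtain ⟨a, ha, rfl⟩ := Finset.mem_image.1 hz
      obtain ⟨b, hb, hab⟩ := Finset.mem_image.1 hz'
      have : a = b := by rw [← hx a (hm a ha), ← hy b (hm b hb), hab]
      subst this
      exact hxy a (hm a ha) hab.symm
    rw [two_mul]
    nth_rw 1 [← d1]
    rw [← d2, ← Finset.card_union_of_disjoint d3]
    apply Finset.card_le_card
    intro z hz
    rw [hKc]
    rcases Finset.mem_union.1 hz with hz | hz <;> obtain ⟨a, ha, rfl⟩ := Finset.mem_image.1 hz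
    · rw [hx a (hm a ha)]; exact Finset.ne_of_mem_erase ha
    · rw [hy a (hm a ha)]; exact Finset.ne_of_mem_erase ha
  omega

theorem hasRank_coline {V : Type} [Fintype V] (G : SimpleGraph V) {W : Type} (α β : V → W)
    (hinj : ∀ u v, α u = α v → β u = β v → u = v)
    (hadj : ∀ u v, u ≠ v → (¬ G.Adj u v ↔ (α u = α v ∨ β u = β v))) :
    HasRank G (2 * Fintype.card V + mm G) := by
  classical
  by_cases hedge : ∃ u v, G.Adj u v
  swap
  · exact hasRank_diamondFree G fun u v x y h => absurd ⟨u, v, h⟩ hedge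
  by_cases hcomp : ∃ u v, u ≠ v ∧ ¬ G.Adj u v
  swap
  · refine hasRank_diamondFree G fun u v x y _ _ _ _ _ hxy => ?_
    by_contra h
    exact hcomp ⟨x, y, hxy, h⟩
  let A : Finset W := (Finset.univ.image α).filter fun w => ∃ u v, u ≠ v ∧ α u = w ∧ α v = w
  let B : Finset W := (Finset.univ.image β).filter fun w => ∃ u v, u ≠ v ∧ β u = w ∧ β v = w
  have hAm : ∀ u v, u ≠ v → α u = α v → α v ∈ A := fun u v h1 h2 => by
    simp only [A, Finset.mem_filter, Finset.mem_image, Finset.mem_univ, true_and]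
    exact ⟨⟨v, rfl⟩, u, v, h1, h2, rfl⟩
  have hBm : ∀ u v, u ≠ v → β u = β v → β v ∈ B := fun u v h1 h2 => by
    simp only [B, Finset.mem_filter, Finset.mem_image, Finset.mem_univ, true_and]
    exact ⟨⟨v, rfl⟩, u, v, h1, h2, rfl⟩
  have hA := coline_count G α β hinj hadj hedge A fun w hw => (Finset.mem_filter.1 hw).2
  have hB := coline_count G β α (fun u v h1 h2 => hinj u v h2 h1)
    (fun u v h => (hadj u v h).trans or_comm) hedge B fun w hw => (Finset.mem_filter.1 hw).2
  let fib : A ⊕ B → Set V := Sum.elim (fun w => {v | α v = w.1}) (fun w => {v | β v = w.1})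
  have := hasRank_fib G fib ?_ ?_
  · refine this.mono ?_
    rw [Fintype.card_sum, Fintype.card_coe, Fintype.card_coe]
    omega
  · rintro (i | i) u hu v hv huv
    · exact (hadj u v huv.ne).2 (Or.inl (hu.trans hv.symm)) huv
    · exact (hadj u v huv.ne).2 (Or.inr (hu.trans hv.symm)) huv
  · intro S
    have hst : ∀ u ∈ S.1, ∀ v ∈ S.1, u ≠ v → (α u = α v ∨ β u = β v) := fun u hu v hv h =>
      (hadj u v h).1 (S.2 u hu v hv)
    rcases Set.subsingleton_or_nontrivial S.1 with hs | ⟨u, hu, v, hv, huv⟩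
    · rcases S.1.eq_empty_or_nonempty with he | ⟨u, hu⟩
      · obtain ⟨u, v, h1, h2⟩ := hcomp
        left
        rcases (hadj u v h1).1 h2 with h | h
        · exact ⟨Sum.inl ⟨α v, hAm u v h1 h⟩, by rw [he]; exact Set.empty_subset _⟩
        · exact ⟨Sum.inr ⟨β v, hBm u v h1 h⟩, by rw [he]; exact Set.empty_subset _⟩
      · exact Or.inr ⟨u, hs.eq_singleton_of_mem hu⟩
    · left
      rcases hst u hu v hv huv with h | h
      · refine ⟨Sum.inl ⟨α v, hAm u v huv h⟩, fun x hx => ?_⟩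
        change α x = α v
        by_contra hne
        have h1 : x ≠ v := by rintro rfl; exact hne rfl
        have h2 : x ≠ u := by rintro rfl; exact hne h
        have h3 := (hst x hx v hv h1).resolve_left hne
        have h4 := (hst x hx u hu h2).resolve_left (by rw [h]; exact hne)
        exact huv (hinj u v h (h4.symm.trans h3))
      · refine ⟨Sum.inr ⟨β v, hBm u v huv h⟩, fun x hx => ?_⟩
        change β x = β v
        by_contra hne
        have h1 : x ≠ v := by rintro rfl; exact hne rfl
        have h2 : x ≠ u := by rintro rfl; exact hne h
        have h3 := (hst x hx v hv h1).resolve_right hne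
        have h4 := (hst x hx u hu h2).resolve_right (by rw [h]; exact hne)
        exact huv (hinj u v (h4.symm.trans h3) h)


theorem ds_ll (p q : ℕ) (L : Fin p → Set (Fin q)) (i i' : Fin p) (s s' : Bool) :
    (doubleSplitGraph p q L).Adj (Sum.inl (i, s)) (Sum.inl (i', s')) ↔ i = i' ∧ s ≠ s' := by
  simp only [doubleSplitGraph, SimpleGraph.fromRel_adj]
  grind

theorem ds_rr (p q : ℕ) (L : Fin p → Set (Fin q)) (j j' : Fin q) (s s' : Bool) :
    (doubleSplitGraph p q L).Adj (Sum.inr (j, s)) (Sum.inr (j', s')) ↔ j ≠ j' ∧ s ≠ s' := by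
  simp only [doubleSplitGraph, SimpleGraph.fromRel_adj]
  grind

theorem ds_lr (p q : ℕ) (L : Fin p → Set (Fin q)) (i : Fin p) (j : Fin q) (s t : Bool) :
    (doubleSplitGraph p q L).Adj (Sum.inl (i, s)) (Sum.inr (j, t)) ↔ (j ∈ L i ↔ s = t) := by
  simp [doubleSplitGraph, SimpleGraph.fromRel_adj]

theorem ds_rl (p q : ℕ) (L : Fin p → Set (Fin q)) (i : Fin p) (j : Fin q) (s t : Bool) :
    (doubleSplitGraph p q L).Adj (Sum.inr (j, t)) (Sum.inl (i, s)) ↔ (j ∈ L i ↔ s = t) := by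
  rw [SimpleGraph.adj_comm, ds_lr]

/-- Half of the vertices of a double-split graph. -/
def dsHalf (p q : ℕ) (b : Bool) :
    ((Fin p × Bool) ⊕ Fin q) ↪ ((Fin p × Bool) ⊕ (Fin q × Bool)) where
  toFun := Sum.map id (fun j => (j, b))
  inj' := by
    rintro (x | x) (y | y) h
    · simpa using h
    · simp at h
    · simp at h
    · simpa using h

theorem hasRank_dsHalf (p q : ℕ) (L : Fin p → Set (Fin q)) (b : Bool) :
    HasRank ((doubleSplitGraph p q L).comap (dsHalf p q b)) (2 * (p * 2 + q) + (p + p * q)) := by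
  have hl : ∀ x, dsHalf p q b (Sum.inl x) = Sum.inl x := fun _ => rfl
  have hr : ∀ j, dsHalf p q b (Sum.inr j) = Sum.inr (j, b) := fun _ => rfl
  have := hasRank_cover ((doubleSplitGraph p q L).comap (dsHalf p q b))
    (ι := Fin p ⊕ (Fin p × Fin q))
    (Sum.elim (fun i => {x | ∃ s, x = Sum.inl (i, s)})
      (fun ij => {x | x = Sum.inr ij.2 ∨ ∃ s, x = Sum.inl (ij.1, s) ∧ (ij.2 ∈ L ij.1 ↔ s = b)}))
    ?_ ?_
  · simpa using this
  · rintro (i | ⟨i, j⟩) x hx y hy hxy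
    · obtain ⟨s, rfl⟩ := hx
      obtain ⟨t, rfl⟩ := hy
      rw [SimpleGraph.comap_adj, hl, hl, ds_ll]
      refine ⟨rfl, ?_⟩
      rintro rfl
      exact hxy rfl
    · rw [SimpleGraph.comap_adj]
      rcases hx with rfl | ⟨s, rfl, hs⟩ <;> rcases hy with rfl | ⟨t, rfl, ht⟩
      · exact absurd rfl hxy
      · rw [hl, hr, ds_rl]; exact ht
      · rw [hl, hr, ds_lr]; exact hs
      · exfalso
        apply hxy
        simp only at hs ht
        have : s = t := by
          by_cases h : j ∈ L i
          · rw [hs.1 h, ht.1 h]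
          · have h1 : ¬ s = b := fun e => h (hs.2 e)
            have h2 : ¬ t = b := fun e => h (ht.2 e)
            cases s <;> cases t <;> cases b <;> simp_all
        rw [this]
  · rintro C hC ⟨u, hu, v, hv, huv⟩
    have hadj : ∀ x ∈ C, ∀ y ∈ C, x ≠ y →
        (doubleSplitGraph p q L).Adj (dsHalf p q b x) (dsHalf p q b y) :=
      fun x hx y hy h => hC hx hy h
    have hll : ∀ i s i' s', Sum.inl (i, s) ∈ C → Sum.inl (i', s') ∈ C → i = i' := by
      intro i s i' s' h1 h2
      by_contra hne
      have := hadj _ h1 _ h2 (by simp [hne])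
      rw [hl, hl, ds_ll] at this
      exact hne this.1
    have hrr : ∀ j j', Sum.inr j ∈ C → Sum.inr j' ∈ C → j = j' := by
      intro j j' h1 h2
      by_contra hne
      have := hadj _ h1 _ h2 (by simp [hne])
      rw [hr, hr, ds_rr] at this
      exact this.2 rfl
    have hlr : ∀ i s j, Sum.inl (i, s) ∈ C → Sum.inr j ∈ C → (j ∈ L i ↔ s = b) := by
      intro i s j h1 h2
      have := hadj _ h1 _ h2 (by simp)
      rwa [hl, hr, ds_lr] at this
    have main : ∀ i s j, Sum.inl (i, s) ∈ C → Sum.inr j ∈ C → C ⊆ {x | x = Sum.inr j ∨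
        ∃ s, x = Sum.inl (i, s) ∧ (j ∈ L i ↔ s = b)} := by
      rintro i s j h1 h2 (⟨i', s'⟩ | j') h3
      · obtain rfl := hll _ _ _ _ h1 h3
        exact Or.inr ⟨s', rfl, hlr _ _ _ h3 h2⟩
      · obtain rfl := hrr _ _ h2 h3
        exact Or.inl rfl
    by_cases hex : ∃ j, Sum.inr j ∈ C
    · obtain ⟨j, hj⟩ := hex
      have : ∃ i s, Sum.inl (i, s) ∈ C := by
        rcases u with ⟨i, s⟩ | ju
        · exact ⟨i, s, hu⟩
        · rcases v with ⟨i, s⟩ | jv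
          · exact ⟨i, s, hv⟩
          · exact absurd (congrArg Sum.inr (hrr _ _ hu hv)) huv
      obtain ⟨i, s, hi⟩ := this
      exact ⟨Sum.inr (i, j), main i s j hi hj⟩
    · rcases u with ⟨i, s⟩ | ju
      · refine ⟨Sum.inl i, ?_⟩
        rintro (⟨i', s'⟩ | j') h3
        · obtain rfl := hll _ _ _ _ hu h3
          exact ⟨s', rfl⟩
        · exact absurd ⟨j', h3⟩ hex
      · exact absurd ⟨ju, hu⟩ hex

theorem mm_ds (p q : ℕ) (L : Fin p → Set (Fin q)) (hq : 2 ≤ q) :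
    2 * p + q + 4 * (p * q) ≤ mm (doubleSplitGraph p q L) := by
  classical
  have hσ : ∀ j : Fin q, ∃ j' : Fin q, j ≠ j' := by
    intro j
    haveI : Nontrivial (Fin q) := Fin.nontrivial_iff_two_le.2 hq
    obtain ⟨j', h⟩ := exists_ne j
    exact ⟨j', h.symm⟩
  choose σ hσ using hσ
  let nb : Fin p → Fin q → Bool → Bool := fun i j t => if j ∈ L i then t else !t
  have hnb : ∀ i j t, j ∈ L i ↔ nb i j t = t := by
    intro i j t
    by_cases h : j ∈ L i <;> simp [nb, h]
  let Dt := {x : ((Fin p × Bool) ⊕ (Fin q × Bool)) × ((Fin p × Bool) ⊕ (Fin q × Bool)) //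
    (doubleSplitGraph p q L).Adj x.1 x.2}
  let ψ : (Fin p × Bool) ⊕ ((Fin p × Fin q × Bool) ⊕ ((Fin p × Fin q × Bool) ⊕ Fin q)) → Dt :=
    Sum.elim (fun x => ⟨(Sum.inl (x.1, x.2), Sum.inl (x.1, !x.2)), (ds_ll ..).2 ⟨rfl, by simp⟩⟩)
    (Sum.elim (fun x => ⟨(Sum.inl (x.1, nb x.1 x.2.1 x.2.2), Sum.inr (x.2.1, x.2.2)),
        (ds_lr ..).2 (hnb ..)⟩)
    (Sum.elim (fun x => ⟨(Sum.inr (x.2.1, x.2.2), Sum.inl (x.1, nb x.1 x.2.1 x.2.2)),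
        (ds_rl ..).2 (hnb ..)⟩)
      (fun j => ⟨(Sum.inr (j, false), Sum.inr (σ j, true)), (ds_rr ..).2 ⟨hσ j, by simp⟩⟩)))
  have hψ : Function.Injective ψ := by
    rintro (⟨i, s⟩ | ⟨i, j, t⟩ | ⟨i, j, t⟩ | j) (⟨i', s'⟩ | ⟨i', j', t'⟩ | ⟨i', j', t'⟩ | j') h <;>
      simp only [ψ, Sum.elim_inl, Sum.elim_inr, Subtype.mk.injEq, Prod.mk.injEq, Sum.inl.injEq,
        Sum.inr.injEq, reduceCtorEq, false_and, and_false] at h <;> grind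
  have := Fintype.card_le_of_injective ψ hψ
  unfold mm
  rw [Nat.card_eq_fintype_card]
  refine le_trans (le_of_eq ?_) this
  simp only [Fintype.card_sum, Fintype.card_prod, Fintype.card_fin, Fintype.card_bool]
  ring

theorem hasRank_ds (p q : ℕ) (L : Fin p → Set (Fin q)) (hp : 2 ≤ p) (hq : 2 ≤ q) :
    HasRank (doubleSplitGraph p q L)
      (2 * (2 * p + 2 * q) + mm (doubleSplitGraph p q L)) := by
  classical
  have hmm := mm_ds p q L hq
  generalize hD : doubleSplitGraph p q L = D at *
  have hh : ∀ b, HasRank (D.comap (dsHalf p q b)) (2 * (p * 2 + q) + (p + p * q)) := fun b => by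
    rw [← hD]; exact hasRank_dsHalf p q L b
  choose F hFc hF using hh
  let e : ∀ b, D.comap (dsHalf p q b) ↪g D := fun b => SimpleGraph.Embedding.comap (dsHalf p q b) D
  have hrange : ∀ b v, v ∉ Set.range (e b) → ∃ j, v = Sum.inr (j, !b) := by
    rintro b (x | ⟨j, s⟩) hv
    · exact absurd ⟨Sum.inl x, rfl⟩ hv
    · refine ⟨j, ?_⟩
      by_cases hs : s = b
      · exact absurd ⟨Sum.inr j, by rw [hs]; rfl⟩ hv
      · have : s = !b := by cases s <;> cases b <;> simp_all
        rw [this]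
  let φ : Bool → Stb D → NNReal := fun b S =>
    if (∀ j, Sum.inr (j, !b) ∉ S.1) ∧ (b = true → ∃ j, Sum.inr (j, true) ∈ S.1) then 1 else 0
  have hφ : ∀ b S, φ b S ≠ 0 → ∀ j, Sum.inr (j, !b) ∉ S.1 := by
    intro b S h
    by_contra hn
    exact h (if_neg fun h' => hn h'.1)
  let δ : Fin q → Stb D → NNReal := fun l S =>
    if Sum.inr (l, false) ∈ S.1 ∧ Sum.inr (l, true) ∈ S.1 then 1 else 0
  let Sl : Fin q → Stb D := fun l => ⟨{x | ∃ s, x = Sum.inr (l, s)}, by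
    rintro _ ⟨s, rfl⟩ _ ⟨t, rfl⟩ h
    rw [← hD, ds_rr] at h
    exact h.1 rfl⟩
  have hSl : ∀ (S : Stb D) l, Sum.inr (l, false) ∈ S.1 → Sum.inr (l, true) ∈ S.1 → S = Sl l := by
    intro S l h1 h2
    have h12 : ∀ s, Sum.inr (l, s) ∈ S.1 := by rintro (_ | _) <;> assumption
    apply Subtype.ext
    ext x
    constructor
    · intro hx
      rcases x with ⟨i, s⟩ | ⟨j, s⟩
      · exfalso
        by_cases h : l ∈ L i
        · apply S.2 _ hx _ (h12 s)
          rw [← hD, ds_lr]; simp [h]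
        · apply S.2 _ hx _ (h12 (!s))
          rw [← hD, ds_lr]; simp [h]
      · by_cases hj : j = l
        · exact ⟨s, by rw [hj]⟩
        · exfalso
          apply S.2 _ hx _ (h12 (!s))
          rw [← hD, ds_rr]; simp [hj]
    · rintro ⟨s, rfl⟩
      exact h12 s
  have hid : ∀ f : Stb D → NNReal,
      f = φ false * f + φ true * f + ∑ l, f (Sl l) • δ l := by
    intro f
    funext S
    simp only [Pi.add_apply, Pi.mul_apply, Finset.sum_apply, Pi.smul_apply, smul_eq_mul]
    by_cases ht : ∃ j, Sum.inr (j, true) ∈ S.1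
    · have h1 : φ false S = 0 := by
        obtain ⟨j, hj⟩ := ht
        refine if_neg fun h => h.1 j hj
      by_cases hf : ∃ j, Sum.inr (j, false) ∈ S.1
      · have h2 : φ true S = 0 := by
          obtain ⟨j, hj⟩ := hf
          refine if_neg fun h => h.1 j hj
        obtain ⟨l, hl⟩ := ht
        obtain ⟨l', hl'⟩ := hf
        have : l = l' := by
          by_contra hne
          apply S.2 _ hl _ hl'
          rw [← hD, ds_rr]; exact ⟨hne, by simp⟩
        subst this
        have hSe := hSl S l hl' hl
        simp only [h1, h2, zero_mul, zero_add]
        rw [Finset.sum_eq_single l]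
        · simp only [δ, hl, hl', and_self, if_true, mul_one]
          rw [hSe]
        · intro m _ hm
          have : ¬ (Sum.inr (m, false) ∈ S.1 ∧ Sum.inr (m, true) ∈ S.1) := by
            rintro ⟨a, -⟩
            apply S.2 _ a _ hl
            rw [← hD, ds_rr]; exact ⟨hm, by simp⟩
          simp only [δ, if_neg this, mul_zero]
        · simp
      · have h2 : φ true S = 1 := if_pos ⟨fun j hj => hf ⟨j, hj⟩, fun _ => ht⟩
        have h3 : ∀ l, δ l S = 0 := fun l => if_neg fun h => hf ⟨l, h.1⟩
        simp [h1, h2, h3]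
    · have h1 : φ false S = 1 := if_pos ⟨fun j hj => ht ⟨j, hj⟩, by simp⟩
      have h2 : φ true S = 0 := if_neg fun h => ht (h.2 rfl)
      have h3 : ∀ l, δ l S = 0 := fun l => if_neg fun h => ht ⟨l, h.2⟩
      simp [h1, h2, h3]
  let M : Bool → Finset (Stb D → NNReal) := fun b => (F b).image (liftFn (e b) (φ b))
  let T : Finset (Stb D → NNReal) := Finset.univ.image δ
  have hall : ∀ f : Stb D → NNReal,
      (∀ b, φ b * f ∈ Submodule.span NNReal (M b : Set (Stb D → NNReal))) →
      f ∈ Submodule.span NNReal ((M false ∪ M true ∪ T : Finset _) : Set (Stb D → NNReal)) := by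
    intro f hf
    rw [hid f]
    refine Submodule.add_mem _ (Submodule.add_mem _ ?_ ?_) (Submodule.sum_mem _ fun l _ =>
      Submodule.smul_mem _ _ (Submodule.subset_span ?_))
    · exact span_mono' (fun x hx => by simp [hx]) (hf false)
    · exact span_mono' (fun x hx => by simp [hx]) (hf true)
    · simp only [Finset.coe_union]
      exact Or.inr (by simp [T])
  refine ⟨M false ∪ M true ∪ T, ?_, ?_, ?_⟩
  · have e1 : (M false).card ≤ _ := Finset.card_image_le.trans (hFc false)
    have e2 : (M true).card ≤ _ := Finset.card_image_le.trans (hFc true)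
    have e3 : T.card ≤ q := Finset.card_image_le.trans (by simp)
    have e4 := Finset.card_union_le (M false) (M true)
    have e5 := Finset.card_union_le (M false ∪ M true) T
    have e6 : 2 * p ≤ p * q := by nlinarith
    omega
  · intro v
    refine hall _ fun b => ?_
    by_cases hv : v ∈ Set.range (e b)
    · obtain ⟨u, rfl⟩ := hv
      exact (hF b).lift_rho (e b) (φ b) u
    · obtain ⟨j, rfl⟩ := hrange b v hv
      have : φ b * rho D (Sum.inr (j, !b)) = 0 := by
        funext S
        by_cases h0 : φ b S = 0
        · simp [h0]
        · have h1 : rho D (Sum.inr (j, !b)) S = 0 := if_neg (hφ b S h0 j)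
          rw [Pi.mul_apply, h1, mul_zero, Pi.zero_apply]
      rw [this]
      exact Submodule.zero_mem _
  · intro C hC _
    refine hall _ fun b => ?_
    have : φ b * sig D C = φ b * sig D (C ∩ Set.range (e b)) := by
      funext S
      by_cases h0 : φ b S = 0
      · simp [h0]
      · have : (∃ v, v ∈ C ∧ v ∈ S.1) ↔ ∃ v, v ∈ C ∩ Set.range (e b) ∧ v ∈ S.1 := by
          constructor
          · rintro ⟨v, h1, h2⟩
            refine ⟨v, ⟨h1, ?_⟩, h2⟩
            by_contra hv
            obtain ⟨j, rfl⟩ := hrange b v hv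
            exact hφ b S h0 j h2
          · rintro ⟨v, h1, h2⟩
            exact ⟨v, h1.1, h2⟩
        have h2 : sig D C S = sig D (C ∩ Set.range (e b)) S := by
          by_cases h : ∃ v, v ∈ C ∧ v ∈ S.1
          · exact (if_pos h).trans (if_pos (this.1 h)).symm
          · exact (if_neg h).trans (if_neg (fun h' => h (this.2 h'))).symm
        rw [Pi.mul_apply, Pi.mul_apply, h2]
    rw [this]
    exact (hF b).lift_sig (e b) (φ b) C hC (Or.inr ⟨Sum.inl (⟨0, by omega⟩, false)⟩)


theorem mm_iso {V V' : Type} [Finite V] {G : SimpleGraph V} {G' : SimpleGraph V'} (e : G' ↪g G) :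
    mm G' ≤ mm G := by
  unfold mm
  refine Nat.card_le_card_of_injective
    (fun x => ⟨(e x.1.1, e x.1.2), e.map_adj_iff.2 x.2⟩ :
      {p : V' × V' // G'.Adj p.1 p.2} → {p : V × V // G.Adj p.1 p.2}) ?_
  rintro ⟨⟨a, b⟩, h⟩ ⟨⟨c, d⟩, h'⟩ heq
  simp only [Subtype.mk.injEq, Prod.mk.injEq] at heq
  have h1 := e.injective heq.1
  have h2 := e.injective heq.2
  subst h1 h2
  rfl

theorem hasRank_basic {V : Type} [Fintype V] (G : SimpleGraph V) (h : IsBasicPerfect G) :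
    HasRank G (2 * Fintype.card V + mm G) := by
  rcases h with h | h | ⟨W, H, hb, ⟨e⟩⟩ | ⟨W, H, hb, ⟨e⟩⟩ | ⟨p, q, L, hp, hq, ⟨e⟩⟩
  · exact hasRank_bipartite G h
  · exact hasRank_cobipartite G h
  · obtain ⟨α, β, hinj, hadj⟩ := lineGraph_coords H hb
    refine hasRank_line G (fun v => α (e v)) (fun v => β (e v))
      (fun u v h1 h2 => e.injective (hinj _ _ h1 h2)) fun u v => ?_
    rw [← e.map_adj_iff, hadj]
    simp
  · obtain ⟨α, β, hinj, hadj⟩ := lineGraph_coords H hb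
    refine hasRank_coline G (fun v => α (e v)) (fun v => β (e v))
      (fun u v h1 h2 => e.injective (hinj _ _ h1 h2)) fun u v huv => ?_
    have h1 := (hadj (e u) (e v)).symm.trans (e.map_adj_iff.trans (SimpleGraph.compl_adj G u v))
    have h2 : e u ≠ e v := fun h => huv (e.injective h)
    simp only [huv, h2, ne_eq, not_false_eq_true, true_and] at h1
    exact h1.symm
  · have h1 := (hasRank_ds p q L hp hq).of_iso e.symm
    refine h1.mono ?_
    have h2 : mm (doubleSplitGraph p q L) ≤ mm G := mm_iso e.symm.toEmbedding
    have h3 := Fintype.card_congr e.toEquiv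
    simp only [Fintype.card_sum, Fintype.card_prod, Fintype.card_fin, Fintype.card_bool] at h3
    omega

theorem hasRank_decomp (d : ℕ) : ∀ (V : Type) [Finite V] (G : SimpleGraph V),
    DecompDepth d V G → HasRank G (4 ^ d * (2 * Nat.card V + mm G)) := by
  induction d with
  | zero =>
    intro V _ G h
    haveI := Fintype.ofFinite V
    have := hasRank_basic G h
    rw [Nat.card_eq_fintype_card]
    simpa using this
  | succ d ih =>
    intro V _ G h
    haveI := Fintype.ofFinite V
    have hsub : ∀ s : Set V, 4 ^ d * (2 * Nat.card s + mm (G.induce s)) ≤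
        4 ^ d * (2 * Nat.card V + mm G) := by
      intro s
      have h1 : mm (G.induce s) ≤ mm G := mm_iso (SimpleGraph.Embedding.induce s)
      have h2 : Nat.card s ≤ Nat.card V := Nat.card_le_card_of_injective _ Subtype.val_injective
      gcongr
    rcases h with h | ⟨V₁, V₂, hj, h1, h2⟩ | ⟨A₁, B₁, A₂, B₂, hs, h1, h2, h3, h4⟩
    · have := hasRank_basic G h
      rw [Nat.card_eq_fintype_card]
      refine this.mono ?_
      exact Nat.le_mul_of_pos_left _ (by positivity)
    · refine (HasRank.two_join hj (ih _ _ h1) (ih _ _ h2)).mono ?_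
      have hc : Nat.card V₁ + Nat.card V₂ = Nat.card V := by
        have := Set.ncard_union_eq hj.2.1 (Set.toFinite _) (Set.toFinite _)
        rw [hj.1, Set.ncard_univ] at this
        exact this.symm
      have hm : mm (G.induce V₁) + mm (G.induce V₂) ≤ mm G := by
        unfold mm
        rw [← Nat.card_sum]
        refine Nat.card_le_card_of_injective (Sum.elim
          (fun x => ⟨(x.1.1.1, x.1.2.1), x.2⟩) (fun x => ⟨(x.1.1.1, x.1.2.1), x.2⟩)) ?_
        have hd := Set.disjoint_left.1 hj.2.1
        rintro (⟨⟨⟨a, ha⟩, ⟨b, hb⟩⟩, h⟩ | ⟨⟨⟨a, ha⟩, ⟨b, hb⟩⟩, h⟩)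
          (⟨⟨⟨a', ha'⟩, ⟨b', hb'⟩⟩, h'⟩ | ⟨⟨⟨a', ha'⟩, ⟨b', hb'⟩⟩, h'⟩) heq <;>
          simp only [Sum.elim_inl, Sum.elim_inr, Subtype.mk.injEq, Prod.mk.injEq] at heq <;>
          obtain ⟨rfl, rfl⟩ := heq
        · rfl
        · exact absurd ha' (hd ha)
        · exact absurd ha (hd ha')
        · rfl
      rw [pow_succ, ← mul_add]
      have : 2 * Nat.card V₁ + mm (G.induce V₁) + (2 * Nat.card V₂ + mm (G.induce V₂)) ≤
        2 * Nat.card V + mm G := by omega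
      have := Nat.mul_le_mul_left (4 ^ d) this
      rw [mul_right_comm]
      omega
    · refine (HasRank.skew hs (ih _ _ h1) (ih _ _ h2) (ih _ _ h3) (ih _ _ h4)).mono ?_
      have e1 := hsub (A₁ ∪ B₁)
      have e2 := hsub (A₂ ∪ B₂)
      have e3 := hsub (A₁ ∪ B₂)
      have e4 := hsub (A₂ ∪ B₁)
      rw [pow_succ, mul_assoc, mul_comm 4, ← mul_assoc]
      omega

theorem mm_eq_edges {V : Type} [Fintype V] (G : SimpleGraph V) [Fintype G.edgeSet] :
    mm G = 2 * G.edgeFinset.card := by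
  classical
  have h1 : mm G = Fintype.card G.Dart := by
    unfold mm
    rw [← Nat.card_eq_fintype_card]
    exact Nat.card_congr
      { toFun := fun x => ⟨x.1, x.2⟩
        invFun := fun x => ⟨x.toProd, x.adj⟩
        left_inv := fun _ => rfl
        right_inv := fun _ => rfl }
  rw [h1, SimpleGraph.dart_card_eq_twice_card_edges]
  congr!


/-- for a perfect graph `G = (V, E)` admitting a decomposition tree of
depth `d` into basic perfect graphs by means of 2-join and skew partition decompositions,
`xc (STAB G) ≤ 4^d ⬝ (2|V| + 2|E|)`.  In particular, if `d ≤ c ⬝ log |V|` for a constant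
`c > 0`, then `xc (STAB G) ≤ 2 |V|^(c+2)`. -/
theorem xc_stab_of_decompDepth {V : Type} [Fintype V] (G : SimpleGraph V)
    [Fintype G.edgeSet] (hG : IsPerfect G) (d : ℕ) (hd : DecompDepth d V G) :
    xc (stab G) ≤ 4 ^ d * (2 * Fintype.card V + 2 * G.edgeFinset.card) ∧
    ∀ c : ℝ, 0 < c → (d : ℝ) ≤ c * Real.logb 4 (Fintype.card V) →
      (xc (stab G) : ℝ) ≤ 2 * (Fintype.card V : ℝ) ^ (c + 2) := by
  classical
  have h1 : xc (stab G) ≤ 4 ^ d * (2 * Fintype.card V + 2 * G.edgeFinset.card) := by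
    have := hasRank_decomp d V G hd
    rw [Nat.card_eq_fintype_card, mm_eq_edges] at this
    exact xc_le_of_hasRank G hG _ this
  refine ⟨h1, fun c hc hdc => ?_⟩
  have hE : G.edgeFinset.card ≤ (Fintype.card V).choose 2 := by
    convert G.card_edgeFinset_le_card_choose_two
  generalize hn : Fintype.card V = n at *
  generalize G.edgeFinset.card = m at *
  rcases Nat.eq_zero_or_pos n with rfl | hpos
  · have hm : m = 0 := by simpa using hE
    have : xc (stab G) = 0 := by
      rw [hm] at h1
      simpa using h1
    rw [this]
    have : (0 : ℝ) ≤ ((0 : ℕ) : ℝ) ^ (c + 2) := Real.rpow_nonneg (by simp) _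
    simp only [Nat.cast_zero] at this ⊢
    linarith
  have hn0 : (0 : ℝ) < n := by exact_mod_cast hpos
  have h4 : (4 : ℝ) ^ d ≤ (n : ℝ) ^ c := by
    rw [← Real.rpow_natCast]
    calc (4 : ℝ) ^ (d : ℝ) ≤ 4 ^ (c * Real.logb 4 n) :=
          Real.rpow_le_rpow_of_exponent_le (by norm_num) hdc
      _ = (n : ℝ) ^ c := by
          rw [mul_comm, Real.rpow_mul (by norm_num),
            Real.rpow_logb (by norm_num) (by norm_num) hn0]
  have hm : 2 * n + 2 * m ≤ 2 * n ^ 2 := by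
    rw [Nat.choose_two_right] at hE
    have e1 : 2 * m ≤ n * (n - 1) := by
      have := Nat.div_mul_le_self (n * (n - 1)) 2
      omega
    obtain ⟨k, rfl⟩ : ∃ k, n = k + 1 := ⟨n - 1, by omega⟩
    simp only [Nat.add_sub_cancel] at e1
    nlinarith
  have hm' : (2 * n + 2 * m : ℝ) ≤ 2 * (n : ℝ) ^ 2 := by exact_mod_cast hm
  have h1' : (xc (stab G) : ℝ) ≤ 4 ^ d * (2 * n + 2 * m) := by exact_mod_cast h1
  refine h1'.trans ?_
  rw [Real.rpow_add hn0, Real.rpow_two]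
  calc (4 : ℝ) ^ d * (2 * n + 2 * m) ≤ (n : ℝ) ^ c * (2 * (n : ℝ) ^ 2) := by
        gcongr
    _ = _ := by ring
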